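/- arXiv:2305.13531 — 2 statements merged into one kernel-verified Lean document; each statement's English description precedes it below -/
import Mathlib

section
/- Proximity to the ground-state orbit near the threshold: for every ε > 0 there exists δ₀ > 0 such that if f : ℝ³ → ℂ is radial, continuously differentiable, with f ∈ L⁶(ℝ³), ∇f ∈ L²(ℝ³), E^c(f) ≤ E^c(W), and |‖∇W‖_{L²}² − ‖∇f‖_{L²}²| < δ₀, then there exist θ ∈ ℝ and μ > 0 such that ‖∇( f − e^{iθ} μ^{1/2} W(μ·) )‖_{L²} < ε. -/
open MeasureTheory Complex
open scoped BigOperators ENNReal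

noncomputable section

abbrev E3 := EuclideanSpace ℝ (Fin 3)

/-- The Aubin–Talenti ground state `W(x) = (1 + |x|²/3)^(-1/2)`. -/
def W (x : E3) : ℝ := (1 + ‖x‖ ^ 2 / 3) ^ (-(1 : ℝ) / 2)

/-- `W` viewed as a complex-valued function. -/
def Wc (x : E3) : ℂ := (W x : ℂ)

/-- Standard basis vectors of ℝ³. -/
def e3 (i : Fin 3) : E3 := EuclideanSpace.single i 1

/-- Partial derivative of a real-valued function. -/
def pdR (i : Fin 3) (f : E3 → ℝ) (x : E3) : ℝ := fderiv ℝ f x (e3 i)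

/-- Partial derivative of a complex-valued function. -/
def pdC (i : Fin 3) (f : E3 → ℂ) (x : E3) : ℂ := fderiv ℝ f x (e3 i)

/-- Squared gradient `|∇f|²` of a real-valued function. -/
def gradSqR (f : E3 → ℝ) (x : E3) : ℝ := ∑ i, (pdR i f x) ^ 2

/-- Squared gradient `|∇f|²` of a complex-valued function. -/
def gradSqC (f : E3 → ℂ) (x : E3) : ℝ := ∑ i, ‖pdC i f x‖ ^ 2

/-- Laplacian of a real-valued function. -/
def lapR (f : E3 → ℝ) (x : E3) : ℝ := ∑ i, pdR i (pdR i f) x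

/-- Laplacian of a complex-valued function. -/
def lapC (f : E3 → ℂ) (x : E3) : ℂ := ∑ i, pdC i (pdC i f) x

/-- Quintic (energy-critical) energy `E^c`. -/
def Ecrit (f : E3 → ℂ) : ℝ := ∫ x : E3, ((1:ℝ)/2 * gradSqC f x - 1/6 * ‖f x‖ ^ 6)

/-- Cubic–quintic energy `E`. -/
def Ecq (f : E3 → ℂ) : ℝ :=
  ∫ x : E3, ((1:ℝ)/2 * gradSqC f x - 1/6 * ‖f x‖ ^ 6 + 1/4 * ‖f x‖ ^ 4)

/-- Regular solutions of the cubic–quintic NLS on an interval `I ⊆ ℝ`. -/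
def IsRegularSolution (I : Set ℝ) (u : ℝ → E3 → ℂ) : Prop :=
  ContDiffOn ℝ (⊤ : ℕ∞) (fun p : ℝ × E3 => u p.1 p.2) (I ×ˢ Set.univ) ∧
  (∀ t ∈ I, ∀ x : E3, Complex.I * deriv (fun s => u s x) t + lapC (u t) x =
      (‖u t x‖ : ℂ) ^ 2 * u t x - (‖u t x‖ : ℂ) ^ 4 * u t x) ∧
  (∀ J : Set ℝ, IsCompact J → J ⊆ I → ∀ n k : ℕ, ∃ C : ℝ, ∀ t ∈ J, ∀ x : E3,
      (1 + ‖x‖) ^ n * ‖iteratedFDeriv ℝ k (u t) x‖ ≤ C)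


/-- A function on ℝ³ is radial if it depends only on the norm. -/
def IsRadial {α : Type*} (f : E3 → α) : Prop := ∀ x y : E3, ‖x‖ = ‖y‖ → f x = f y

/-- The rescaled, rotated ground state `e^{iθ} μ^{1/2} W(μ·)`. -/
def groundC (θ μ : ℝ) (x : E3) : ℂ :=
  Complex.exp (θ * Complex.I) * (Real.sqrt μ : ℂ) * (W (μ • x) : ℂ)

/-- Half of the slope `√(1 - |z|⁴/m²)` of the profile equation. -/
def profileSlope (m : ℝ) (z : ℂ) : ℝ := √(1 - (‖z‖ ^ 2 / m) ^ 2) / 2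

lemma profileSlope_nonneg (m : ℝ) (z : ℂ) : 0 ≤ profileSlope m z := by
  unfold profileSlope; positivity

lemma profileSlope_le_half (m : ℝ) (z : ℂ) : profileSlope m z ≤ 1 / 2 := by
  unfold profileSlope
  have : √(1 - (‖z‖ ^ 2 / m) ^ 2) ≤ 1 := Real.sqrt_le_one.mpr (by nlinarith [sq_nonneg (‖z‖ ^ 2 / m)])
  linarith

lemma continuous_profileSlope (m : ℝ) : Continuous (profileSlope m) := by
  unfold profileSlope; fun_prop

/-- Comparison for `y' ≤ √(y² - 1 + σ)`, `y(0) = 1`. -/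
lemma le_cosh_add_of_deriv_le {y y' : ℝ → ℝ} {σ T : ℝ} (hσ : 0 < σ) (hT : 0 ≤ T)
    (hy : ∀ t, HasDerivAt y (y' t) t) (hy0 : y 0 = 1) (hy1 : ∀ t ∈ Set.Icc 0 T, 1 ≤ y t)
    (hle : ∀ t ∈ Set.Icc 0 T, y' t ≤ √(y t ^ 2 - 1 + σ)) :
    y T ≤ Real.cosh T + √σ * Real.sinh T := by
  set s : ℝ → ℝ := fun t => √(y t ^ 2 - 1 + σ) with hs
  have hpos : ∀ t ∈ Set.Icc 0 T, 0 < y t ^ 2 - 1 + σ := fun t ht => by nlinarith [hy1 t ht]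
  have hspos : ∀ t ∈ Set.Icc 0 T, 0 < s t := fun t ht => Real.sqrt_pos.mpr (hpos t ht)
  have hderiv : ∀ t ∈ Set.Icc 0 T, HasDerivAt (fun t => (y t + s t) * Real.exp (-t))
      ((y' t + (2 * y t * y' t) / (2 * s t)) * Real.exp (-t) + (y t + s t) * (-Real.exp (-t))) t := by
    intro t ht
    have h1 : HasDerivAt (fun t => y t ^ 2 - 1 + σ) (2 * y t * y' t) t := by
      have := (((hy t).pow 2).sub_const 1).add_const σ
      simpa using this
    have h2 := h1.sqrt (hpos t ht).ne'
    have h3 : HasDerivAt (fun t : ℝ => Real.exp (-t)) (-Real.exp (-t)) t := by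
      simpa using (hasDerivAt_neg t).exp
    exact ((hy t).add h2).mul h3
  have hanti : AntitoneOn (fun t => (y t + s t) * Real.exp (-t)) (Set.Icc 0 T) := by
    refine antitoneOn_of_deriv_nonpos (convex_Icc 0 T)
      (fun t ht => (hderiv t ht).continuousAt.continuousWithinAt) ?_ ?_
    · intro t ht
      rw [interior_Icc] at ht
      exact (hderiv t (Set.Ioo_subset_Icc_self ht)).differentiableAt.differentiableWithinAt
    · intro t ht
      rw [interior_Icc] at ht
      have ht := Set.Ioo_subset_Icc_self ht
      rw [(hderiv t ht).deriv]
      have h1 := hspos t ht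
      have h2 := hy1 t ht
      have h3 : y' t ≤ s t := hle t ht
      have h4 : y' t + 2 * y t * y' t / (2 * s t) ≤ y t + s t := by
        have : 2 * y t * y' t / (2 * s t) ≤ y t := by
          rw [div_le_iff₀ (by positivity)]; nlinarith
        linarith
      nlinarith [Real.exp_pos (-t)]
  have h := hanti (Set.left_mem_Icc.mpr hT) (Set.right_mem_Icc.mpr hT) hT
  simp only [neg_zero, Real.exp_zero, mul_one] at h
  have hs0 : s 0 = √σ := by simp [hs, hy0]
  rw [hs0, hy0] at h
  have hq : y T + s T ≤ Real.exp T * (1 + √σ) := by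
    have h5 : Real.exp (-T) * Real.exp T = 1 := by rw [← Real.exp_add]; simp
    have := mul_le_mul_of_nonneg_right h (Real.exp_pos T).le
    rw [mul_assoc, h5] at this
    linarith
  by_contra! hcon
  set Y := Real.cosh T + √σ * Real.sinh T with hY
  have hsh : 0 ≤ Real.sinh T := Real.sinh_nonneg_iff.mpr hT
  have hch : 0 < Real.cosh T := Real.cosh_pos T
  have hsσ : √σ ^ 2 = σ := Real.sq_sqrt hσ.le
  have hsσ0 := Real.sqrt_nonneg σ
  have hS : Real.sinh T + √σ * Real.cosh T ≤ s T := by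
    apply Real.le_sqrt_of_sq_le
    have hcs := Real.cosh_sq T
    have : Y ^ 2 ≤ y T ^ 2 := by
      have : 0 ≤ Y := by positivity
      nlinarith
    have : (Real.sinh T + √σ * Real.cosh T) ^ 2 = Y ^ 2 - 1 + σ := by
      rw [hY]; ring_nf; rw [hsσ, hcs]; ring
    linarith
  have := Real.cosh_add_sinh T
  nlinarith

/-- A solution of `v' = -profileSlope · v + r` starting at its maximum `√m` stays above the
explicit profile, up to an error controlled by `∫ |r|²`. -/
lemma re_lower_bound {v : ℝ → ℂ} (hv : ContDiff ℝ 1 v) {m D T : ℝ} (hm : 0 < m)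
    (h0 : v 0 = (√m : ℝ)) (hT : 0 ≤ T) (hD : 0 < D)
    (hle : ∀ t, ‖v t‖ ^ 2 ≤ m)
    (hint : ∫ t in (0 : ℝ)..T, ‖deriv v t + (profileSlope m (v t) : ℂ) * v t‖ ^ 2 ≤ D) :
    √m / √(Real.cosh T + √(4 * (Real.exp (T / 2) * √((T + 1) * D)) / √m) * Real.sinh T)
      - Real.exp (T / 2) * √((T + 1) * D) ≤ (v T).re := by
  set e := Real.exp (T / 2) * √((T + 1) * D) with he
  have he0 : 0 < e := by positivity
  set k : ℝ → ℝ := fun t => profileSlope m (v t) with hk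
  have hkc : Continuous k := (continuous_profileSlope m).comp hv.continuous
  set K : ℝ → ℝ := fun t => ∫ s in (0 : ℝ)..t, k s with hK
  have hKd : ∀ t, HasDerivAt K (k t) t := fun t => hkc.integral_hasStrictDerivAt 0 t |>.hasDerivAt
  have hKc : Continuous K := continuous_iff_continuousAt.mpr fun t => (hKd t).continuousAt
  have hK0 : K 0 = 0 := by simp [hK]
  have hKnn : ∀ t, 0 ≤ t → 0 ≤ K t := fun t ht =>
    intervalIntegral.integral_nonneg ht fun s _ => profileSlope_nonneg _ _
  have hKle : ∀ t ∈ Set.Icc 0 T, K t ≤ T / 2 := by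
    intro t ht
    have : K t ≤ ∫ s in (0 : ℝ)..t, (1 / 2 : ℝ) :=
      intervalIntegral.integral_mono_on ht.1 (hkc.intervalIntegrable _ _) (by simp)
        fun s _ => profileSlope_le_half _ _
    simp at this
    linarith [ht.2]
  set r : ℝ → ℂ := fun t => deriv v t + (k t : ℂ) * v t with hr
  have hvd : ∀ t, HasDerivAt v (deriv v t) t := fun t =>
    (hv.differentiable one_ne_zero t).hasDerivAt
  have hvc := hv.continuous
  have hdc : Continuous (deriv v) := hv.continuous_deriv le_rfl
  have hrc : Continuous r := by fun_prop
  set Z : ℝ → ℂ := fun t => (Real.exp (K t) : ℂ) * v t with hZ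
  have hZd : ∀ t, HasDerivAt Z ((Real.exp (K t) : ℂ) * r t) t := by
    intro t
    have h1 : HasDerivAt (fun t => (Real.exp (K t) : ℂ)) ((Real.exp (K t) * k t : ℝ) : ℂ) t :=
      (hKd t).exp.ofReal_comp
    refine (h1.mul (hvd t)).congr_deriv ?_
    simp only [hr]; push_cast; ring
  have hL1 : ∫ t in (0 : ℝ)..T, ‖r t‖ ≤ √((T + 1) * D) := by
    apply Real.le_sqrt_of_sq_le
    set I := ∫ t in (0 : ℝ)..T, ‖r t‖ with hI
    have hI0 : 0 ≤ I := intervalIntegral.integral_nonneg hT fun _ _ => norm_nonneg _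
    set c := I / (T + 1) with hc
    have hT1 : 0 < T + 1 := by linarith
    have hcI : c * (T + 1) = I := by rw [hc]; field_simp
    have h2 : ∫ t in (0 : ℝ)..T, (2 * c * ‖r t‖ - c ^ 2) ≤ ∫ t in (0 : ℝ)..T, ‖r t‖ ^ 2 := by
      refine intervalIntegral.integral_mono_on hT ?_ ?_ ?_
      · exact Continuous.intervalIntegrable (by fun_prop) _ _
      · exact Continuous.intervalIntegrable (by fun_prop) _ _
      · intro t _; nlinarith [sq_nonneg (‖r t‖ - c)]
    rw [intervalIntegral.integral_sub (Continuous.intervalIntegrable (by fun_prop) _ _) (by simp),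
      intervalIntegral.integral_const_mul] at h2
    simp only [intervalIntegral.integral_const, smul_eq_mul, sub_zero, ← hI] at h2
    have h3 : 2 * c * I - T * c ^ 2 ≤ D := h2.trans hint
    have hc0 : 0 ≤ c := by positivity
    have h4 : c ^ 2 * (T + 1) ≤ D := by rw [← hcI] at h3; nlinarith [sq_nonneg c]
    calc I ^ 2 = (T + 1) * (c ^ 2 * (T + 1)) := by rw [← hcI]; ring
      _ ≤ (T + 1) * D := by gcongr
  have hZe : ∀ t ∈ Set.Icc 0 T, ‖Z t - (√m : ℝ)‖ ≤ e := by
    intro t ht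
    have h1 : ∫ s in (0 : ℝ)..t, (Real.exp (K s) : ℂ) * r s = Z t - Z 0 :=
      intervalIntegral.integral_eq_sub_of_hasDerivAt (fun s _ => hZd s)
        (Continuous.intervalIntegrable (by fun_prop) _ _)
    have h2 : Z 0 = (√m : ℝ) := by simp [hZ, hK0, h0]
    rw [← h2, ← h1]
    refine (intervalIntegral.norm_integral_le_integral_norm ht.1).trans ?_
    have h3 : ∫ s in (0 : ℝ)..t, ‖(Real.exp (K s) : ℂ) * r s‖
        ≤ ∫ s in (0 : ℝ)..t, Real.exp (T / 2) * ‖r s‖ := by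
      refine intervalIntegral.integral_mono_on ht.1 ?_ ?_ ?_
      · exact Continuous.intervalIntegrable (by fun_prop) _ _
      · exact Continuous.intervalIntegrable (by fun_prop) _ _
      · intro s hs
        rw [norm_mul, Complex.norm_real, Real.norm_eq_abs, abs_of_pos (Real.exp_pos _)]
        gcongr
        exact hKle s ⟨hs.1, hs.2.trans ht.2⟩
    have h4 : ∫ s in (0 : ℝ)..t, ‖r s‖ ≤ ∫ s in (0 : ℝ)..T, ‖r s‖ :=
      intervalIntegral.integral_mono_interval le_rfl ht.1 ht.2
        (Filter.Eventually.of_forall fun _ => norm_nonneg _)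
        (Continuous.intervalIntegrable (by fun_prop) _ _)
    rw [intervalIntegral.integral_const_mul] at h3
    refine h3.trans ?_
    rw [he]
    gcongr
    exact h4.trans hL1
  have hsm : 0 < √m := Real.sqrt_pos.mpr hm
  have hsm2 : √m ^ 2 = m := Real.sq_sqrt hm.le
  have hZre : ∀ t ∈ Set.Icc 0 T, √m - e ≤ (Z t).re := by
    intro t ht
    have h1 := (abs_le.mp ((Complex.abs_re_le_norm _).trans (hZe t ht))).1
    simp only [Complex.sub_re, Complex.ofReal_re] at h1
    linarith
  set y : ℝ → ℝ := fun t => Real.exp (2 * K t) with hy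
  have hyd : ∀ t, HasDerivAt y (2 * k t * y t) t := by
    intro t
    have := ((hKd t).const_mul 2).exp
    convert this using 1
    simp only [hy]; ring
  set σ := 4 * e / √m with hσ
  have hσ0 : 0 < σ := by positivity
  have hyT : y T ≤ Real.cosh T + √σ * Real.sinh T := by
    refine le_cosh_add_of_deriv_le hσ0 hT hyd (by simp [hy, hK0]) ?_ ?_
    · intro t ht
      exact Real.one_le_exp (by linarith [hKnn t ht.1])
    · intro t ht
      apply Real.le_sqrt_of_sq_le
      set ρ := ‖v t‖ ^ 2 with hρ
      have hρm : ρ / m ≤ 1 := (div_le_one hm).mpr (hle t)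
      have hρ0 : 0 ≤ ρ / m := by positivity
      have h2k : (2 * k t) ^ 2 = 1 - (ρ / m) ^ 2 := by
        simp only [hk, profileSlope]
        rw [mul_div_cancel₀ _ two_ne_zero, Real.sq_sqrt]
        nlinarith
      have hyZ : ρ * y t = ‖Z t‖ ^ 2 := by
        simp only [hZ, norm_mul, Complex.norm_real, Real.norm_eq_abs, abs_of_pos (Real.exp_pos _),
          mul_pow, hy, two_mul, Real.exp_add]
        ring
      have hre : (Z t).re ≤ ‖Z t‖ := Complex.re_le_norm _
      have hre' := hZre t ht
      have h5 : m - 2 * √m * e ≤ ρ * y t := by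
        rw [hyZ]; nlinarith [sq_nonneg (‖Z t‖ - √m)]
      have h6 : 1 - 2 * e / √m ≤ ρ / m * y t := by
        have : 1 - 2 * e / √m = (m - 2 * √m * e) / m := by
          rw [sub_div, div_self hm.ne']
          congr 1
          nth_rewrite 3 [← hsm2]
          field_simp
        rw [this, div_mul_eq_mul_div]
        gcongr
      have h7 : 1 - σ ≤ (ρ / m * y t) ^ 2 := by
        have : σ = 2 * (2 * e / √m) := by rw [hσ]; ring
        nlinarith [sq_nonneg (ρ / m * y t - 1)]
      rw [mul_pow, h2k]
      nlinarith
  have hZT := hZre T (Set.right_mem_Icc.mpr hT)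
  have hE : (Z T).re = Real.exp (K T) * (v T).re := Complex.re_ofReal_mul _ _
  rw [hE] at hZT
  have hE1 : 1 ≤ Real.exp (K T) := Real.one_le_exp (hKnn T hT)
  have hE2 : Real.exp (K T) ≤ √(Real.cosh T + √σ * Real.sinh T) := by
    apply Real.le_sqrt_of_sq_le
    refine le_trans (le_of_eq ?_) hyT
    simp only [hy]; rw [two_mul, Real.exp_add, sq]
  have h8 : √m / √(Real.cosh T + √σ * Real.sinh T) ≤ √m / Real.exp (K T) := by gcongr
  have h9 : √m / Real.exp (K T) - e ≤ (v T).re := by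
    have hp := Real.exp_pos (K T)
    rw [sub_le_iff_le_add, div_le_iff₀ hp]
    nlinarith
  linarith

/-- The Dirichlet energy in Emden–Fowler coordinates. -/
def emdenGrad (v : ℝ → ℂ) : ℝ := ∫ t, ‖deriv v t - v t / 2‖ ^ 2

/-- The sextic potential energy in Emden–Fowler coordinates. -/
def emdenPot (v : ℝ → ℂ) : ℝ := ∫ t, ‖v t‖ ^ 6

/-- Primitive of the slope as a function of the squared modulus. -/
def slopePrimitive (m x : ℝ) : ℝ := ∫ s in (0 : ℝ)..x, √(1 - (s / m) ^ 2) / 2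

lemma hasDerivAt_slopePrimitive (m x : ℝ) :
    HasDerivAt (slopePrimitive m) (√(1 - (x / m) ^ 2) / 2) x := by
  have hc : Continuous fun s : ℝ => √(1 - (s / m) ^ 2) / 2 := by fun_prop
  exact (hc.integral_hasStrictDerivAt 0 x).hasDerivAt

lemma slopePrimitive_zero (m : ℝ) : slopePrimitive m 0 = 0 := by simp [slopePrimitive]

lemma slopePrimitive_self {m : ℝ} (hm : 0 < m) : slopePrimitive m m = Real.pi * m / 8 := by
  have h1 : ∫ x in (0 : ℝ)..1, √(1 - x ^ 2) = Real.pi / 4 := by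
    have h2 := integral_sqrt_one_sub_sq
    have hi : ∀ a b : ℝ, IntervalIntegrable (fun x : ℝ => √(1 - x ^ 2)) volume a b := fun a b =>
      Continuous.intervalIntegrable (by fun_prop) _ _
    rw [← intervalIntegral.integral_add_adjacent_intervals (hi (-1) 0) (hi 0 1)] at h2
    have h3 : ∫ x in (-1 : ℝ)..0, √(1 - x ^ 2) = ∫ x in (0 : ℝ)..1, √(1 - x ^ 2) := by
      have := intervalIntegral.integral_comp_neg (a := -1) (b := 0) (fun x : ℝ => √(1 - x ^ 2))
      simpa using this
    linarith
  unfold slopePrimitive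
  rw [intervalIntegral.integral_div,
    intervalIntegral.integral_comp_div (fun x => √(1 - x ^ 2)) hm.ne', zero_div, div_self hm.ne', h1,
    smul_eq_mul]
  ring

/-- Completing the square in the Emden–Fowler energy on an interval. -/
lemma integral_residual_eq {v : ℝ → ℂ} (hv : ContDiff ℝ 1 v) {m : ℝ} (hm : 0 < m)
    (hle : ∀ t, ‖v t‖ ^ 2 ≤ m) {s : ℝ} (hs : s ^ 2 = 1) (a b : ℝ) :
    ∫ t in a..b, ‖deriv v t + (s * profileSlope m (v t) : ℝ) * v t‖ ^ 2 =
      (∫ t in a..b, (‖deriv v t - v t / 2‖ ^ 2 - ‖v t‖ ^ 6 / (4 * m ^ 2)))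
      + ((‖v b‖ ^ 2 / 2 + s * slopePrimitive m (‖v b‖ ^ 2))
        - (‖v a‖ ^ 2 / 2 + s * slopePrimitive m (‖v a‖ ^ 2))) := by
  have hvc := hv.continuous
  have hdc : Continuous (deriv v) := hv.continuous_deriv le_rfl
  have hvd : ∀ t, HasDerivAt v (deriv v t) t := fun t =>
    (hv.differentiable one_ne_zero t).hasDerivAt
  have hkc : Continuous fun t => profileSlope m (v t) := (continuous_profileSlope m).comp hvc
  have hd : ∀ t, HasDerivAt (fun t => ‖v t‖ ^ 2 / 2 + s * slopePrimitive m (‖v t‖ ^ 2))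
      ((1 / 2 + s * profileSlope m (v t)) * (2 * inner ℝ (v t) (deriv v t))) t := by
    intro t
    have h1 := (hvd t).norm_sq
    have h2 := (hasDerivAt_slopePrimitive m (‖v t‖ ^ 2)).comp t h1
    refine ((h1.div_const 2).add (h2.const_mul s)).congr_deriv ?_
    unfold profileSlope
    ring
  rw [← intervalIntegral.integral_eq_sub_of_hasDerivAt (fun t _ => hd t)
    (Continuous.intervalIntegrable (by fun_prop) _ _), ← intervalIntegral.integral_add
    (Continuous.intervalIntegrable (by fun_prop) _ _)
    (Continuous.intervalIntegrable (by fun_prop) _ _)]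
  congr 1
  funext t
  have hk2 : profileSlope m (v t) ^ 2 = (1 - (‖v t‖ ^ 2 / m) ^ 2) / 4 := by
    unfold profileSlope
    have : ‖v t‖ ^ 2 / m ≤ 1 := (div_le_one hm).mpr (hle t)
    have h0 : 0 ≤ ‖v t‖ ^ 2 / m := by positivity
    rw [div_pow, Real.sq_sqrt (by nlinarith)]
    norm_num
  set k := profileSlope m (v t)
  set z := v t
  set d := deriv v t
  have e1 : ‖d + (s * k : ℝ) * z‖ ^ 2 = ‖d‖ ^ 2 + 2 * (s * k) * inner ℝ z d + k ^ 2 * ‖z‖ ^ 2 := by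
    have : k ^ 2 = (s * k) ^ 2 := by rw [mul_pow, hs, one_mul]
    rw [this]
    simp only [Complex.sq_norm, Complex.normSq_apply, Complex.inner, Complex.add_re, Complex.add_im,
      Complex.mul_re, Complex.mul_im, Complex.ofReal_re, Complex.ofReal_im, Complex.conj_re,
      Complex.conj_im]
    ring
  have e2 : ‖d - z / 2‖ ^ 2 = ‖d‖ ^ 2 - inner ℝ z d + ‖z‖ ^ 2 / 4 := by
    have : z / 2 = ((1 / 2 : ℝ) : ℂ) * z := by push_cast; ring
    rw [this]
    simp only [Complex.sq_norm, Complex.normSq_apply, Complex.inner, Complex.sub_re, Complex.sub_im,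
      Complex.mul_re, Complex.mul_im, Complex.ofReal_re, Complex.ofReal_im, Complex.conj_re,
      Complex.conj_im]
    ring
  rw [e1, e2, hk2]
  field_simp
  ring

/-- If `|v|²` attains its maximum `m` at `0`, both one-sided residuals are controlled by the
deficit of `v`. -/
lemma residual_le_deficit {v : ℝ → ℂ} (hv : ContDiff ℝ 1 v) {m : ℝ} (hm : 0 < m)
    (hle : ∀ t, ‖v t‖ ^ 2 ≤ m) (h0 : ‖v 0‖ ^ 2 = m)
    (htop : Filter.Tendsto v Filter.atTop (nhds 0)) (hbot : Filter.Tendsto v Filter.atBot (nhds 0))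
    (hA : Integrable fun t => ‖deriv v t - v t / 2‖ ^ 2) (hB : Integrable fun t => ‖v t‖ ^ 6)
    {T : ℝ} (hT : 0 ≤ T) :
    (∫ t in (0 : ℝ)..T, ‖deriv v t + (profileSlope m (v t) : ℂ) * v t‖ ^ 2) +
    (∫ t in (-T)..0, ‖deriv v t - (profileSlope m (v t) : ℂ) * v t‖ ^ 2)
      ≤ emdenGrad v - emdenPot v / (4 * m ^ 2) - Real.pi * m / 4 := by
  have hvc := hv.continuous
  have hdc : Continuous (deriv v) := hv.continuous_deriv le_rfl
  have hkc : Continuous fun t => profileSlope m (v t) := (continuous_profileSlope m).comp hvc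
  set F : ℝ → ℝ := fun T =>
    (∫ t in (0 : ℝ)..T, ‖deriv v t + (profileSlope m (v t) : ℂ) * v t‖ ^ 2) +
    (∫ t in (-T)..0, ‖deriv v t - (profileSlope m (v t) : ℂ) * v t‖ ^ 2) with hF
  have hFeq : ∀ b, F b = (∫ t in (-b)..b, (‖deriv v t - v t / 2‖ ^ 2 - ‖v t‖ ^ 6 / (4 * m ^ 2)))
      + ((‖v b‖ ^ 2 / 2 + slopePrimitive m (‖v b‖ ^ 2))
        - (‖v (-b)‖ ^ 2 / 2 - slopePrimitive m (‖v (-b)‖ ^ 2))) - Real.pi * m / 4 := by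
    intro b
    have h1 := integral_residual_eq hv hm hle (s := 1) (by norm_num) 0 b
    have h2 := integral_residual_eq hv hm hle (s := -1) (by norm_num) (-b) 0
    have h3 := slopePrimitive_self hm
    simp only [one_mul, h0, h3] at h1
    simp only [neg_mul, one_mul, h0, h3, Complex.ofReal_neg, ← sub_eq_add_neg] at h2
    rw [hF]
    simp only
    rw [h1, h2, ← intervalIntegral.integral_add_adjacent_intervals (a := -b) (b := 0) (c := b)
      (Continuous.intervalIntegrable (by fun_prop) _ _)
      (Continuous.intervalIntegrable (by fun_prop) _ _)]
    ring
  have hint : Integrable fun t => ‖deriv v t - v t / 2‖ ^ 2 - ‖v t‖ ^ 6 / (4 * m ^ 2) :=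
    hA.sub (hB.div_const _)
  have hIeq : ∫ t, (‖deriv v t - v t / 2‖ ^ 2 - ‖v t‖ ^ 6 / (4 * m ^ 2))
      = emdenGrad v - emdenPot v / (4 * m ^ 2) := by
    rw [integral_sub hA (hB.div_const _), integral_div, emdenGrad, emdenPot]
  have hsp : Continuous (slopePrimitive m) :=
    continuous_iff_continuousAt.mpr fun x => (hasDerivAt_slopePrimitive m x).continuousAt
  have hq : Continuous fun z : ℂ => ‖z‖ ^ 2 / 2 + slopePrimitive m (‖z‖ ^ 2) := by fun_prop
  have hq' : Continuous fun z : ℂ => ‖z‖ ^ 2 / 2 - slopePrimitive m (‖z‖ ^ 2) := by fun_prop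
  have hlim : Filter.Tendsto F Filter.atTop
      (nhds (emdenGrad v - emdenPot v / (4 * m ^ 2) + (0 - 0) - Real.pi * m / 4)) := by
    rw [funext hFeq, ← hIeq]
    refine ((intervalIntegral_tendsto_integral hint Filter.tendsto_neg_atTop_atBot
      Filter.tendsto_id).add (Filter.Tendsto.sub ?_ ?_)).sub_const _
    · have := (hq.tendsto 0).comp htop
      simpa [slopePrimitive_zero, Function.comp_def] using this
    · have := (hq'.tendsto 0).comp (hbot.comp Filter.tendsto_neg_atTop_atBot)
      simpa [slopePrimitive_zero, Function.comp_def] using this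
  rw [sub_zero, add_zero] at hlim
  refine ge_of_tendsto hlim ?_
  filter_upwards [Filter.eventually_ge_atTop T] with b hb
  refine add_le_add ?_ ?_
  · exact intervalIntegral.integral_mono_interval le_rfl hT hb
      (Filter.Eventually.of_forall fun _ => sq_nonneg _)
      (Continuous.intervalIntegrable (by fun_prop) _ _)
  · exact intervalIntegral.integral_mono_interval (by linarith) (by linarith) le_rfl
      (Filter.Eventually.of_forall fun _ => sq_nonneg _)
      (Continuous.intervalIntegrable (by fun_prop) _ _)

/-- The ground state in centred Emden–Fowler coordinates. -/
def emdenProfile (t : ℝ) : ℝ := √(√3 / (2 * Real.cosh t))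

/-- The radial derivative of the ground state in centred Emden–Fowler coordinates. -/
def emdenProfileGrad (t : ℝ) : ℝ := -(1 + Real.sinh t / Real.cosh t) / 2 * emdenProfile t

lemma emdenProfile_pos (t : ℝ) : 0 < emdenProfile t := by
  have := Real.cosh_pos t
  unfold emdenProfile; positivity

lemma emdenProfile_sq (t : ℝ) : emdenProfile t ^ 2 = √3 / (2 * Real.cosh t) := by
  have := Real.cosh_pos t
  unfold emdenProfile
  exact Real.sq_sqrt (by positivity)

lemma contDiff_emdenProfile : ContDiff ℝ 1 emdenProfile := by
  unfold emdenProfile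
  refine ContDiff.sqrt (ContDiff.div contDiff_const (by fun_prop) fun t => ?_) fun t => ?_
  · have := Real.cosh_pos t; positivity
  · have := Real.cosh_pos t; positivity

lemma continuous_emdenProfile : Continuous emdenProfile := contDiff_emdenProfile.continuous

lemma continuous_emdenProfileGrad : Continuous emdenProfileGrad := by
  unfold emdenProfileGrad
  have := continuous_emdenProfile
  have h : ∀ t, Real.cosh t ≠ 0 := fun t => (Real.cosh_pos t).ne'
  fun_prop (disch := exact h _)

lemma hasDerivAt_emdenProfile (t : ℝ) :
    HasDerivAt emdenProfile (-(Real.sinh t / Real.cosh t) / 2 * emdenProfile t) t := by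
  have hc := Real.cosh_pos t
  have hw := emdenProfile_pos t
  have h1 : HasDerivAt (fun t => √3 / (2 * Real.cosh t))
      ((0 * (2 * Real.cosh t) - √3 * (2 * Real.sinh t)) / (2 * Real.cosh t) ^ 2) t :=
    (hasDerivAt_const t (√3)).div ((Real.hasDerivAt_cosh t).const_mul 2) (by positivity)
  refine (h1.sqrt (by positivity)).congr_deriv ?_
  change _ / (2 * emdenProfile t) = _
  rw [div_eq_iff (by positivity)]
  have : -(Real.sinh t / Real.cosh t) / 2 * emdenProfile t * (2 * emdenProfile t)
    = -(Real.sinh t / Real.cosh t) * emdenProfile t ^ 2 := by ring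
  rw [this, emdenProfile_sq]
  field_simp
  ring

lemma hasDerivAt_emdenProfileGrad (t : ℝ) :
    HasDerivAt emdenProfileGrad (-emdenProfile t ^ 5 - emdenProfileGrad t / 2) t := by
  have hc := Real.cosh_pos t
  have h1 := ((((Real.hasDerivAt_sinh t).div (Real.hasDerivAt_cosh t) hc.ne').const_add 1).neg.div_const
    2).mul (hasDerivAt_emdenProfile t)
  refine h1.congr_deriv ?_
  have h4 : emdenProfile t ^ 5 = 3 / (4 * Real.cosh t ^ 2) * emdenProfile t := by
    have : emdenProfile t ^ 5 = (emdenProfile t ^ 2) ^ 2 * emdenProfile t := by ring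
    rw [this, emdenProfile_sq, div_pow, Real.sq_sqrt (by norm_num)]
    ring
  rw [h4]
  unfold emdenProfileGrad
  simp only [Pi.neg_apply, Pi.div_apply]
  have hs := Real.cosh_sq t
  have hs' : Real.sinh t ^ 2 = Real.cosh t ^ 2 - 1 := by linarith
  field_simp
  ring_nf
  rw [hs']
  ring

lemma inv_cosh_le (t : ℝ) : (Real.cosh t)⁻¹ ≤ 4 * (1 + t ^ 2)⁻¹ := by
  have h : (1 + t ^ 2) / 4 ≤ Real.cosh t := by
    rw [← Real.cosh_abs, Real.cosh_eq]
    have h1 := Real.quadratic_le_exp_of_nonneg (abs_nonneg t)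
    have h2 := Real.exp_pos (-|t|)
    rw [sq_abs] at h1
    have := abs_nonneg t
    linarith
  have h0 : 0 < (1 + t ^ 2) / 4 := by positivity
  calc (Real.cosh t)⁻¹ ≤ ((1 + t ^ 2) / 4)⁻¹ := inv_anti₀ h0 h
    _ = _ := by rw [inv_div]; ring

lemma integrable_emdenProfile_sq : Integrable fun t => emdenProfile t ^ 2 := by
  refine ((integrable_inv_one_add_sq.const_mul 4).const_mul (√3 / 2)).mono'
    (by have := continuous_emdenProfile; fun_prop) (Filter.Eventually.of_forall fun t => ?_)
  rw [Real.norm_eq_abs, abs_of_nonneg (sq_nonneg _), emdenProfile_sq]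
  calc √3 / (2 * Real.cosh t) = √3 / 2 * (Real.cosh t)⁻¹ := by ring
    _ ≤ _ := by gcongr; exact inv_cosh_le t

lemma emdenProfile_le_one (t : ℝ) : emdenProfile t ≤ 1 := by
  have h1 := Real.one_le_cosh t
  have h3 : √3 ≤ 2 := by rw [Real.sqrt_le_left (by norm_num)]; norm_num
  unfold emdenProfile
  rw [Real.sqrt_le_one, div_le_one (by positivity)]
  linarith

lemma integrable_emdenProfile_pow {n : ℕ} (hn : 2 ≤ n) :
    Integrable fun t => emdenProfile t ^ n := by
  refine integrable_emdenProfile_sq.mono' (by have := continuous_emdenProfile; fun_prop)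
    (Filter.Eventually.of_forall fun t => ?_)
  rw [Real.norm_eq_abs, abs_of_nonneg (pow_nonneg (emdenProfile_pos t).le _)]
  exact pow_le_pow_of_le_one (emdenProfile_pos t).le (emdenProfile_le_one t) hn

lemma abs_emdenProfileGrad_le (t : ℝ) : |emdenProfileGrad t| ≤ emdenProfile t := by
  have hc := Real.cosh_pos t
  have hw := emdenProfile_pos t
  unfold emdenProfileGrad
  rw [abs_mul, abs_of_pos hw]
  have h1 : |Real.sinh t / Real.cosh t| ≤ 1 := by
    rw [abs_div, abs_of_pos hc, div_le_one hc]
    apply abs_le_of_sq_le_sq _ hc.le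
    rw [Real.cosh_sq]; linarith
  have h2 : |-(1 + Real.sinh t / Real.cosh t) / 2| ≤ 1 := by
    rw [abs_le] at h1 ⊢
    constructor <;> linarith [h1.1, h1.2]
  nlinarith

lemma integrable_emdenProfileGrad_sq : Integrable fun t => emdenProfileGrad t ^ 2 := by
  refine integrable_emdenProfile_sq.mono' (by have := continuous_emdenProfileGrad; fun_prop)
    (Filter.Eventually.of_forall fun t => ?_)
  rw [Real.norm_eq_abs, abs_of_nonneg (sq_nonneg _), sq_le_sq, abs_of_pos (emdenProfile_pos t)]
  exact abs_emdenProfileGrad_le t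

lemma tendsto_inv_cosh : Filter.Tendsto (fun t => (Real.cosh t)⁻¹) (Filter.cocompact ℝ) (nhds 0) := by
  refine squeeze_zero (fun t => (inv_pos.mpr (Real.cosh_pos t)).le) inv_cosh_le ?_
  have h : Filter.Tendsto (fun t : ℝ => 1 + t ^ 2) (Filter.cocompact ℝ) Filter.atTop := by
    refine Filter.tendsto_atTop_add_const_left _ _ ?_
    have := (Filter.tendsto_pow_atTop (α := ℝ) two_ne_zero).comp (tendsto_norm_cocompact_atTop (E := ℝ))
    simpa [Function.comp_def] using this
  simpa using h.inv_tendsto_atTop.const_mul 4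

lemma tendsto_emdenProfile : Filter.Tendsto emdenProfile (Filter.cocompact ℝ) (nhds 0) := by
  have h : emdenProfile = fun t => √(√3 / 2 * (Real.cosh t)⁻¹) := by
    funext t; unfold emdenProfile; congr 1; ring
  rw [h]
  have := (tendsto_inv_cosh.const_mul (√3 / 2)).sqrt
  simpa using this

/-- The value of the sextic energy of the ground state. -/
lemma integral_emdenProfile_pow_six : ∫ t, emdenProfile t ^ 6 = 3 * √3 / 16 * Real.pi := by
  have h6 : ∀ t, emdenProfile t ^ 6 = 3 * √3 / 8 * (Real.cosh t ^ 3)⁻¹ := by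
    intro t
    have : emdenProfile t ^ 6 = (emdenProfile t ^ 2) ^ 3 := by ring
    rw [this, emdenProfile_sq, div_pow, pow_succ (√3) 2, Real.sq_sqrt (by norm_num)]
    ring
  have hd : ∀ t, HasDerivAt
      (fun t => (Real.sinh t * (Real.cosh t)⁻¹ ^ 2 + Real.arctan (Real.sinh t)) / 2)
      ((Real.cosh t ^ 3)⁻¹) t := by
    intro t
    have hc := Real.cosh_pos t
    have h1 := ((Real.hasDerivAt_sinh t).mul (((Real.hasDerivAt_cosh t).inv hc.ne').pow 2)).add
      (Real.hasDerivAt_sinh t).arctan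
    refine (h1.div_const 2).congr_deriv ?_
    have hs : 1 + Real.sinh t ^ 2 = Real.cosh t ^ 2 := by rw [Real.cosh_sq]; ring
    have hs' : Real.sinh t ^ 2 = Real.cosh t ^ 2 - 1 := by rw [Real.cosh_sq]; ring
    rw [hs]
    simp only [Pi.inv_apply, Pi.pow_apply, Nat.add_one_sub_one, pow_one, Nat.cast_ofNat]
    field_simp
    ring_nf
    rw [hs']
    ring
  have hi : Integrable fun t => (Real.cosh t ^ 3)⁻¹ := by
    have := (integrable_emdenProfile_pow (n := 6) (by norm_num)).const_mul (8 / (3 * √3))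
    refine this.congr (Filter.Eventually.of_forall fun t => ?_)
    simp only [h6]
    field_simp
  have hsmall : Filter.Tendsto (fun t => Real.sinh t * (Real.cosh t)⁻¹ ^ 2) (Filter.cocompact ℝ)
      (nhds 0) := by
    refine squeeze_zero_norm (fun t => ?_) tendsto_inv_cosh
    have hc := Real.cosh_pos t
    have : |Real.sinh t| ≤ Real.cosh t := by
      apply abs_le_of_sq_le_sq _ hc.le
      rw [Real.cosh_sq]; linarith
    rw [Real.norm_eq_abs, abs_mul, abs_of_nonneg (sq_nonneg (Real.cosh t)⁻¹)]
    calc |Real.sinh t| * (Real.cosh t)⁻¹ ^ 2 ≤ Real.cosh t * (Real.cosh t)⁻¹ ^ 2 := by gcongr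
      _ = (Real.cosh t)⁻¹ := by field_simp
  have hst : Filter.Tendsto Real.sinh Filter.atTop Filter.atTop := by
    refine Filter.tendsto_atTop_mono' _ ?_ Filter.tendsto_id
    filter_upwards [Filter.eventually_ge_atTop 0] with t ht
    exact Real.self_le_sinh_iff.mpr ht
  have hsb : Filter.Tendsto Real.sinh Filter.atBot Filter.atBot := by
    have := Filter.tendsto_neg_atTop_atBot.comp (hst.comp Filter.tendsto_neg_atBot_atTop)
    simpa [Function.comp_def] using this
  have ht := ((hsmall.mono_left atTop_le_cocompact).add
    ((tendsto_nhds_of_tendsto_nhdsWithin Real.tendsto_arctan_atTop).comp hst)).div_const 2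
  have hb := ((hsmall.mono_left atBot_le_cocompact).add
    ((tendsto_nhds_of_tendsto_nhdsWithin Real.tendsto_arctan_atBot).comp hsb)).div_const 2
  have := integral_of_hasDerivAt_of_tendsto hd hi hb ht
  simp only [h6]
  rw [integral_const_mul, this]
  ring

/-- Testing the equation of the ground state against `v`. -/
lemma integral_grad_mul_emdenProfileGrad {v : ℝ → ℂ} (hv : ContDiff ℝ 1 v) {m : ℝ}
    (hle : ∀ t, ‖v t‖ ^ 2 ≤ m) (hA : Integrable fun t => ‖deriv v t - v t / 2‖ ^ 2) :
    Integrable (fun t => (deriv v t - v t / 2).re * emdenProfileGrad t) ∧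
    Integrable (fun t => (v t).re * emdenProfile t ^ 5) ∧
    ∫ t, (deriv v t - v t / 2).re * emdenProfileGrad t = ∫ t, (v t).re * emdenProfile t ^ 5 := by
  have hvc := hv.continuous
  have hdc : Continuous (deriv v) := hv.continuous_deriv le_rfl
  have hpc := continuous_emdenProfileGrad
  have hwc := continuous_emdenProfile
  have hrec := Complex.continuous_re
  have hb : ∀ t, |(v t).re| ≤ √m := fun t =>
    (Complex.abs_re_le_norm _).trans (Real.le_sqrt_of_sq_le (hle t))
  have hi1 : Integrable (fun t => (deriv v t - v t / 2).re * emdenProfileGrad t) := by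
    refine (hA.add integrable_emdenProfileGrad_sq).mono'
      (Continuous.aestronglyMeasurable (by fun_prop)) (Filter.Eventually.of_forall fun t => ?_)
    have h1 := Complex.abs_re_le_norm (deriv v t - v t / 2)
    rw [Real.norm_eq_abs, abs_mul]
    simp only [Pi.add_apply]
    nlinarith [sq_nonneg (|(deriv v t - v t / 2).re| - |emdenProfileGrad t|),
      abs_nonneg (deriv v t - v t / 2).re, sq_abs (emdenProfileGrad t),
      sq_nonneg (|(deriv v t - v t / 2).re| + |emdenProfileGrad t|)]
  have hi2 : Integrable (fun t => (v t).re * emdenProfile t ^ 5) := by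
    refine ((integrable_emdenProfile_pow (n := 5) (by norm_num)).const_mul (√m)).mono'
      (Continuous.aestronglyMeasurable (by fun_prop)) (Filter.Eventually.of_forall fun t => ?_)
    rw [Real.norm_eq_abs, abs_mul, abs_of_nonneg (pow_nonneg (emdenProfile_pos t).le 5)]
    have := pow_nonneg (emdenProfile_pos t).le 5
    gcongr
    exact hb t
  refine ⟨hi1, hi2, ?_⟩
  have hd : ∀ t, HasDerivAt (fun t => (v t).re * emdenProfileGrad t)
      ((deriv v t - v t / 2).re * emdenProfileGrad t - (v t).re * emdenProfile t ^ 5) t := by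
    intro t
    have h1 : HasDerivAt (fun t => (v t).re) (deriv v t).re t :=
      (Complex.reCLM.hasFDerivAt.comp_hasDerivAt t
        (hv.differentiable one_ne_zero t).hasDerivAt)
    refine (h1.mul (hasDerivAt_emdenProfileGrad t)).congr_deriv ?_
    simp only [Complex.sub_re, Complex.div_ofNat_re]
    ring
  have hz : Filter.Tendsto (fun t => (v t).re * emdenProfileGrad t) (Filter.cocompact ℝ) (nhds 0) := by
    have h := tendsto_emdenProfile.const_mul (√m)
    rw [mul_zero] at h
    refine squeeze_zero_norm (fun t => ?_) h
    rw [Real.norm_eq_abs, abs_mul]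
    exact mul_le_mul (hb t) (abs_emdenProfileGrad_le t) (abs_nonneg _) (Real.sqrt_nonneg _)
  have := integral_of_hasDerivAt_of_tendsto hd (hi1.sub hi2) (hz.mono_left atBot_le_cocompact)
    (hz.mono_left atTop_le_cocompact)
  rw [integral_sub hi1 hi2] at this
  linarith

lemma deriv_emdenProfile_sub (t : ℝ) : deriv (fun t => (emdenProfile t : ℂ)) t -
    (emdenProfile t : ℂ) / 2 = (emdenProfileGrad t : ℂ) := by
  rw [(hasDerivAt_emdenProfile t).ofReal_comp.deriv]
  unfold emdenProfileGrad
  push_cast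
  ring

lemma contDiff_emdenProfile_ofReal : ContDiff ℝ 1 fun t => (emdenProfile t : ℂ) :=
  Complex.ofRealCLM.contDiff.comp contDiff_emdenProfile

lemma integral_emdenProfileGrad_sq : ∫ t, emdenProfileGrad t ^ 2 = 3 * √3 / 16 * Real.pi := by
  have h := integral_grad_mul_emdenProfileGrad contDiff_emdenProfile_ofReal (m := 1) (fun t => by
    have h0 := (emdenProfile_pos t).le
    rw [Complex.norm_real, Real.norm_eq_abs, abs_of_nonneg h0]
    exact pow_le_one₀ h0 (emdenProfile_le_one t)) (by
      simp only [deriv_emdenProfile_sub, Complex.norm_real, Real.norm_eq_abs, sq_abs]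
      exact integrable_emdenProfileGrad_sq)
  have h2 := h.2.2
  simp only [deriv_emdenProfile_sub, Complex.ofReal_re, ← pow_two, ← pow_succ'] at h2
  rw [h2]
  exact integral_emdenProfile_pow_six

lemma emdenGrad_emdenProfile : emdenGrad (fun t => (emdenProfile t : ℂ)) = 3 * √3 / 16 * Real.pi := by
  unfold emdenGrad
  simp only [deriv_emdenProfile_sub, Complex.norm_real, Real.norm_eq_abs, sq_abs]
  exact integral_emdenProfileGrad_sq

lemma emdenPot_emdenProfile : emdenPot (fun t => (emdenProfile t : ℂ)) = 3 * √3 / 16 * Real.pi := by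
  unfold emdenPot
  simp only [Complex.norm_real, Real.norm_eq_abs, (Even.pow_abs (by decide : Even 6))]
  exact integral_emdenProfile_pow_six

/-- The distance to the ground state in terms of the overlap. -/
lemma emdenGrad_sub_emdenProfile {v : ℝ → ℂ} (hv : ContDiff ℝ 1 v) {m : ℝ}
    (hle : ∀ t, ‖v t‖ ^ 2 ≤ m) (hA : Integrable fun t => ‖deriv v t - v t / 2‖ ^ 2) :
    emdenGrad (fun t => v t - (emdenProfile t : ℂ)) = emdenGrad v - 3 * √3 / 16 * Real.pi
      + 2 * ∫ t, (emdenProfile t - (v t).re) * emdenProfile t ^ 5 := by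
  obtain ⟨hi1, hi2, he⟩ := integral_grad_mul_emdenProfileGrad hv hle hA
  have hpt : ∀ t, ‖deriv (fun t => v t - (emdenProfile t : ℂ)) t - (v t - (emdenProfile t : ℂ)) / 2‖ ^ 2
      = ‖deriv v t - v t / 2‖ ^ 2 + emdenProfileGrad t ^ 2
        - 2 * ((deriv v t - v t / 2).re * emdenProfileGrad t) := by
    intro t
    have h1 : deriv (fun t => v t - (emdenProfile t : ℂ)) t =
        deriv v t - deriv (fun t => (emdenProfile t : ℂ)) t :=
      deriv_fun_sub (hv.differentiable one_ne_zero t)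
        (contDiff_emdenProfile_ofReal.differentiable one_ne_zero t)
    have h2 : deriv v t - deriv (fun t => (emdenProfile t : ℂ)) t - (v t - (emdenProfile t : ℂ)) / 2
        = (deriv v t - v t / 2) - (emdenProfileGrad t : ℂ) := by
      rw [← deriv_emdenProfile_sub]; ring
    rw [h1, h2]
    simp only [Complex.sq_norm, Complex.normSq_apply, Complex.sub_re, Complex.sub_im,
      Complex.ofReal_re, Complex.ofReal_im]
    ring
  have h3 : ∫ t, (emdenProfile t - (v t).re) * emdenProfile t ^ 5 =
      3 * √3 / 16 * Real.pi - ∫ t, (v t).re * emdenProfile t ^ 5 := by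
    rw [← integral_emdenProfile_pow_six,
      ← integral_sub (integrable_emdenProfile_pow (by norm_num)) hi2]
    congr 1; funext t; ring
  rw [h3, emdenGrad]
  simp only [hpt]
  have hsum : Integrable fun t => ‖deriv v t - v t / 2‖ ^ 2 + emdenProfileGrad t ^ 2 :=
    hA.add integrable_emdenProfileGrad_sq
  rw [integral_sub hsum (hi1.const_mul 2),
    integral_add hA integrable_emdenProfileGrad_sq, integral_const_mul, he,
    integral_emdenProfileGrad_sq, emdenGrad]
  ring

/-- The lower barrier for a near-optimiser with maximum `√m` and defect `δ`. -/
def lowerBarrier (T m δ : ℝ) : ℝ :=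
  √m / √(Real.cosh T + √(4 * (Real.exp (T / 2) * √((T + 1) * (4 * δ))) / √m) * Real.sinh T)
    - Real.exp (T / 2) * √((T + 1) * (4 * δ))

lemma tendsto_lowerBarrier (T : ℝ) {m δ : ℕ → ℝ}
    (hm : Filter.Tendsto m Filter.atTop (nhds (√3 / 2)))
    (hδ : Filter.Tendsto δ Filter.atTop (nhds 0)) :
    Filter.Tendsto (fun n => lowerBarrier T (m n) (δ n)) Filter.atTop (nhds (emdenProfile T)) := by
  have hc := Real.cosh_pos T
  have hw : emdenProfile T = lowerBarrier T (√3 / 2) 0 := by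
    simp only [lowerBarrier, mul_zero, Real.sqrt_zero, zero_div, zero_mul, add_zero, sub_zero]
    rw [emdenProfile, ← Real.sqrt_div (by positivity)]
    congr 1
    rw [div_div]
  rw [hw]
  unfold lowerBarrier
  have he : Filter.Tendsto (fun n => Real.exp (T / 2) * √((T + 1) * (4 * δ n))) Filter.atTop
      (nhds (Real.exp (T / 2) * √((T + 1) * (4 * 0)))) :=
    ((hδ.const_mul 4).const_mul (T + 1)).sqrt.const_mul _
  refine (Filter.Tendsto.div hm.sqrt ?_ ?_).sub he
  · refine ((((he.const_mul 4).div hm.sqrt ?_).sqrt.mul_const _).const_add _).sqrt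
    positivity
  · simp only [mul_zero, Real.sqrt_zero, zero_div, zero_mul, add_zero]
    positivity

/-- A near-optimiser of the Emden–Fowler energy, centred at its maximum. -/
structure IsCentredNearOptimiser (v : ℝ → ℂ) (m δ : ℝ) : Prop where
  contDiff : ContDiff ℝ 1 v
  pos : 0 < m
  le : ∀ t, ‖v t‖ ^ 2 ≤ m
  zero : v 0 = (√m : ℝ)
  top : Filter.Tendsto v Filter.atTop (nhds 0)
  bot : Filter.Tendsto v Filter.atBot (nhds 0)
  grad : Integrable fun t => ‖deriv v t - v t / 2‖ ^ 2
  pot : Integrable fun t => ‖v t‖ ^ 6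
  near : |3 * √3 / 16 * Real.pi - emdenGrad v| < δ
  energy : emdenGrad v / 2 - emdenPot v / 6 ≤ (3 * √3 / 16 * Real.pi) / 3

namespace IsCentredNearOptimiser

variable {v : ℝ → ℂ} {m δ : ℝ}

lemma residual_nonneg (v : ℝ → ℂ) {T : ℝ} (hT : 0 ≤ T) :
    0 ≤ (∫ t in (0 : ℝ)..T, ‖deriv v t + (profileSlope m (v t) : ℂ) * v t‖ ^ 2) ∧
    0 ≤ ∫ t in (-T)..0, ‖deriv v t - (profileSlope m (v t) : ℂ) * v t‖ ^ 2 :=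
  ⟨intervalIntegral.integral_nonneg hT fun _ _ => sq_nonneg _,
    intervalIntegral.integral_nonneg (by linarith) fun _ _ => sq_nonneg _⟩

lemma residual_le (h : IsCentredNearOptimiser v m δ) {T : ℝ} (hT : 0 ≤ T) :
    (∫ t in (0 : ℝ)..T, ‖deriv v t + (profileSlope m (v t) : ℂ) * v t‖ ^ 2) +
    (∫ t in (-T)..0, ‖deriv v t - (profileSlope m (v t) : ℂ) * v t‖ ^ 2)
      ≤ emdenGrad v - emdenPot v / (4 * m ^ 2) - Real.pi * m / 4 := by
  refine residual_le_deficit h.contDiff h.pos h.le ?_ h.top h.bot h.grad h.pot hT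
  rw [h.zero, Complex.norm_real, Real.norm_eq_abs, sq_abs, Real.sq_sqrt h.pos.le]

/-- The cubic governing the sharp inequality has a double root at the optimal maximum. -/
lemma optimal_cubic (m : ℝ) : Real.pi * m ^ 3 - 4 * (3 * √3 / 16 * Real.pi) * m ^ 2
    + 3 * √3 / 16 * Real.pi = Real.pi * ((m - √3 / 2) ^ 2 * (m + √3 / 4)) := by
  have h3 : √3 ^ 2 = 3 := Real.sq_sqrt (by norm_num)
  linear_combination (-Real.pi * √3 / 16) * h3

lemma max_near_and_deficit_le (h : IsCentredNearOptimiser v m δ) (hδ : δ ≤ 1 / 100) :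
    (m - √3 / 2) ^ 2 ≤ 9 * δ ∧
    emdenGrad v - emdenPot v / (4 * m ^ 2) - Real.pi * m / 4 ≤ 4 * δ := by
  have hm := h.pos
  have h0 : 0 ≤ emdenGrad v - emdenPot v / (4 * m ^ 2) - Real.pi * m / 4 := by
    have := h.residual_le le_rfl
    simpa using this
  have hc := optimal_cubic m
  have h3 : √3 ^ 2 = 3 := Real.sq_sqrt (by norm_num)
  have h3' : (1.7 : ℝ) ≤ √3 := Real.le_sqrt_of_sq_le (by norm_num)
  have h3'' : √3 ≤ 1.8 := by rw [Real.sqrt_le_left (by norm_num)]; norm_num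
  have hpi := Real.pi_gt_three
  obtain ⟨hn1, hn2⟩ := abs_lt.mp h.near
  have hen := h.energy
  set A₀ := 3 * √3 / 16 * Real.pi
  set A := emdenGrad v
  set B := emdenPot v
  have hB : A₀ - 3 * δ ≤ B := by linarith
  have hδ0 : 0 < δ := by linarith [abs_nonneg (A₀ - A), h.near]
  have hmul : B ≤ 4 * m ^ 2 * A - Real.pi * m ^ 3 := by
    have : 4 * m ^ 2 * (A - B / (4 * m ^ 2) - Real.pi * m / 4)
        = 4 * m ^ 2 * A - B - Real.pi * m ^ 3 := by field_simp
    have h4 := mul_nonneg (by positivity : 0 ≤ 4 * m ^ 2) h0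
    linarith
  have hsq : (m - √3 / 2) ^ 2 ≤ 9 * δ := by
    set x := (m - √3 / 2) ^ 2 with hx
    have hx0 : 0 ≤ x := sq_nonneg _
    have h5 : Real.pi * (x * (m + √3 / 4)) ≤ 4 * m ^ 2 * δ + 3 * δ := by
      rw [← hc]; nlinarith [sq_nonneg m]
    have h6 : 4 * m ^ 2 + 3 ≤ 8 * x + 9 := by
      rw [hx]; nlinarith [sq_nonneg (m - √3)]
    have h7 : x * 1.275 ≤ Real.pi * (x * (m + √3 / 4)) := by
      have : (0.425 : ℝ) ≤ m + √3 / 4 := by linarith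
      have : x * 0.425 ≤ x * (m + √3 / 4) := by gcongr
      nlinarith
    nlinarith
  refine ⟨hsq, ?_⟩
  have hmlow : 1 / 2 ≤ m := by nlinarith
  have hle : Real.pi * ((m - √3 / 2) ^ 2 * (m + √3 / 4)) ≥ 0 := by positivity
  have h8 : 4 * m ^ 2 * (A - B / (4 * m ^ 2) - Real.pi * m / 4) ≤ 4 * m ^ 2 * (4 * δ) := by
    have : 4 * m ^ 2 * (A - B / (4 * m ^ 2) - Real.pi * m / 4)
        = 4 * m ^ 2 * A - B - Real.pi * m ^ 3 := by field_simp
    rw [this]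
    have h9 : 1 / 4 ≤ m ^ 2 := by nlinarith
    nlinarith [mul_nonneg (sq_nonneg m) (by linarith : 0 ≤ A₀ + δ - A),
      mul_nonneg hδ0.le (by linarith : 0 ≤ m ^ 2 - 1 / 4)]
  exact le_of_mul_le_mul_left h8 (by positivity)

lemma lowerBarrier_le (h : IsCentredNearOptimiser v m δ) (hδ : δ ≤ 1 / 100) (t : ℝ) :
    lowerBarrier |t| m δ ≤ (v t).re := by
  have hδ0 : 0 < δ := by linarith [abs_nonneg (3 * √3 / 16 * Real.pi - emdenGrad v), h.near]
  have hd := (h.max_near_and_deficit_le hδ).2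
  have hr := h.residual_le (abs_nonneg t)
  obtain ⟨hn1, hn2⟩ := residual_nonneg (m := m) v (abs_nonneg t)
  have hvd := h.contDiff.differentiable one_ne_zero
  rcases le_total 0 t with ht | ht
  · rw [abs_of_nonneg ht] at *
    exact re_lower_bound h.contDiff h.pos h.zero ht (by positivity) h.le (by linarith)
  · rw [abs_of_nonpos ht] at *
    have hcomp : ∀ s, deriv (fun s => v (-s)) s = -deriv v (-s) := fun s => deriv_comp_neg v s
    have := re_lower_bound (v := fun s => v (-s)) (h.contDiff.comp contDiff_neg) h.pos
      (by simpa using h.zero) (T := -t) (by linarith) (D := 4 * δ) (by positivity)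
      (fun s => h.le _) ?_
    · simp only [neg_neg] at this
      exact this
    · have h2 := intervalIntegral.integral_comp_neg (a := 0) (b := -t)
        (fun s => ‖deriv v s - (profileSlope m (v s) : ℂ) * v s‖ ^ 2)
      rw [neg_zero] at h2
      have h3 : ∀ s, ‖deriv (fun s => v (-s)) s + (profileSlope m (v (-s)) : ℂ) * v (-s)‖ ^ 2
          = ‖deriv v (-s) - (profileSlope m (v (-s)) : ℂ) * v (-s)‖ ^ 2 := by
        intro s
        rw [hcomp, ← norm_neg]
        congr 2
        ring
      simp only [h3]
      rw [h2]
      linarith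

end IsCentredNearOptimiser

/-- Near-optimisers have almost maximal overlap with the ground state. -/
lemma exists_overlap_lt {ε : ℝ} (hε : 0 < ε) : ∃ δ > 0, ∀ v m, IsCentredNearOptimiser v m δ →
    ∫ t, (emdenProfile t - (v t).re) * emdenProfile t ^ 5 < ε := by
  by_contra! hcon
  set δ : ℕ → ℝ := fun n => 1 / 100 * (1 / ((n : ℝ) + 1)) with hδ
  have hδpos : ∀ n, 0 < δ n := fun n => by simp only [hδ]; positivity
  have hδle : ∀ n, δ n ≤ 1 / 100 := fun n => by
    have : 1 / ((n : ℝ) + 1) ≤ 1 := by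
      rw [div_le_one (by positivity)]; linarith [(Nat.cast_nonneg n : (0 : ℝ) ≤ n)]
    simp only [hδ]; linarith
  have hδlim : Filter.Tendsto δ Filter.atTop (nhds 0) := by
    have := (tendsto_one_div_add_atTop_nhds_zero_nat (𝕜 := ℝ)).const_mul (1 / 100)
    simpa [hδ] using this
  choose v m hv hge using fun n => hcon (δ n) (hδpos n)
  have hmsq : ∀ n, (m n - √3 / 2) ^ 2 ≤ 9 * δ n := fun n =>
    ((hv n).max_near_and_deficit_le (hδle n)).1
  have hmlim : Filter.Tendsto m Filter.atTop (nhds (√3 / 2)) := by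
    rw [tendsto_iff_norm_sub_tendsto_zero]
    have h1 : Filter.Tendsto (fun n => √(9 * δ n)) Filter.atTop (nhds 0) := by
      have := (hδlim.const_mul 9).sqrt
      simpa using this
    refine squeeze_zero (fun _ => norm_nonneg _) (fun n => ?_) h1
    exact Real.abs_le_sqrt (hmsq n)
  have hm4 : ∀ n, √(m n) ≤ 2 := by
    intro n
    rw [Real.sqrt_le_left (by norm_num)]
    have h3'' : √3 ≤ 1.8 := by rw [Real.sqrt_le_left (by norm_num)]; norm_num
    nlinarith [hmsq n, hδle n]
  have hwc := continuous_emdenProfile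
  have hcont : ∀ n, Continuous fun t => ((v n) t).re := fun n =>
    Complex.continuous_re.comp (hv n).contDiff.continuous
  have hre : ∀ n t, |((v n) t).re| ≤ 2 := fun n t =>
    ((Complex.abs_re_le_norm _).trans (Real.le_sqrt_of_sq_le ((hv n).le t))).trans (hm4 n)
  have hw5 : ∀ t, 0 ≤ emdenProfile t ^ 5 := fun t => pow_nonneg (emdenProfile_pos t).le 5
  have hw5i := (integrable_emdenProfile_pow (n := 5) (by norm_num)).const_mul 3
  have hbd : ∀ n t, |max (emdenProfile t - ((v n) t).re) 0| ≤ 3 := by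
    intro n t
    have h1 := abs_le.mp (hre n t)
    have h2 := emdenProfile_le_one t
    rw [abs_of_nonneg (le_max_right _ _)]
    exact max_le (by linarith [h1.1]) (by norm_num)
  have hdom : ∀ n t, ‖max (emdenProfile t - ((v n) t).re) 0 * emdenProfile t ^ 5‖
      ≤ 3 * emdenProfile t ^ 5 := by
    intro n t
    rw [norm_mul, Real.norm_eq_abs, Real.norm_eq_abs, abs_of_nonneg (hw5 t)]
    exact mul_le_mul_of_nonneg_right (hbd n t) (hw5 t)
  have hmeas : ∀ n, AEStronglyMeasurable
      (fun t => max (emdenProfile t - ((v n) t).re) 0 * emdenProfile t ^ 5) volume := fun n => by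
    have := hcont n
    exact Continuous.aestronglyMeasurable (by fun_prop)
  have hlim : Filter.Tendsto
      (fun n => ∫ t, max (emdenProfile t - ((v n) t).re) 0 * emdenProfile t ^ 5)
      Filter.atTop (nhds (∫ _ : ℝ, (0 : ℝ))) := by
    refine tendsto_integral_of_dominated_convergence _ hmeas hw5i
      (fun n => Filter.Eventually.of_forall (hdom n)) (Filter.Eventually.of_forall fun t => ?_)
    have hL := tendsto_lowerBarrier |t| hmlim hδlim
    have habs : emdenProfile |t| = emdenProfile t := by unfold emdenProfile; rw [Real.cosh_abs]
    rw [habs] at hL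
    have h1 : Filter.Tendsto (fun n => max (emdenProfile t - lowerBarrier |t| (m n) (δ n)) 0)
        Filter.atTop (nhds 0) := by
      have := (hL.const_sub (emdenProfile t)).max (tendsto_const_nhds (x := (0 : ℝ)))
      simpa using this
    have h2 : Filter.Tendsto (fun n => max (emdenProfile t - ((v n) t).re) 0)
        Filter.atTop (nhds 0) := by
      refine squeeze_zero (fun _ => le_max_right _ _) (fun n => ?_) h1
      exact max_le_max_right _ (sub_le_sub_left ((hv n).lowerBarrier_le (hδle n) t) _)
    simpa using h2.mul_const (emdenProfile t ^ 5)
  rw [integral_zero] at hlim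
  obtain ⟨n, hn⟩ := (hlim.eventually_lt_const hε).exists
  refine absurd (hge n) (not_le.mpr (lt_of_le_of_lt ?_ hn))
  refine integral_mono ?_ (hw5i.mono' (hmeas n) (Filter.Eventually.of_forall (hdom n))) fun t => ?_
  · refine hw5i.mono' ?_ (Filter.Eventually.of_forall fun t => ?_)
    · have := hcont n
      exact Continuous.aestronglyMeasurable (by fun_prop)
    · have h1 := abs_le.mp (hre n t)
      have h2 := emdenProfile_le_one t
      have h3 := emdenProfile_pos t
      rw [norm_mul, Real.norm_eq_abs, Real.norm_eq_abs, abs_of_nonneg (hw5 t)]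
      refine mul_le_mul_of_nonneg_right ?_ (hw5 t)
      rw [abs_le]; constructor <;> linarith [h1.1, h1.2]
  · exact mul_le_mul_of_nonneg_right (le_max_left _ _) (hw5 t)

lemma deriv_const_mul_comp_add (c : ℂ) (f : ℝ → ℂ) (a t : ℝ) :
    deriv (fun t => c * f (t + a)) t = c * deriv f (t + a) := by
  rw [deriv_const_mul_field, deriv_comp_add_const]

lemma norm_grad_const_mul_comp_add (c : ℂ) (f : ℝ → ℂ) (a t : ℝ) :
    ‖deriv (fun t => c * f (t + a)) t - c * f (t + a) / 2‖ ^ 2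
      = ‖c‖ ^ 2 * ‖deriv f (t + a) - f (t + a) / 2‖ ^ 2 := by
  rw [deriv_const_mul_comp_add, ← mul_pow, ← norm_mul]
  congr 2
  ring

lemma emdenGrad_const_mul_comp_add {c : ℂ} (hc : ‖c‖ = 1) (f : ℝ → ℂ) (a : ℝ) :
    emdenGrad (fun t => c * f (t + a)) = emdenGrad f := by
  unfold emdenGrad
  simp only [norm_grad_const_mul_comp_add, hc, one_pow, one_mul]
  exact integral_add_right_eq_self (fun t => ‖deriv f t - f t / 2‖ ^ 2) a

lemma emdenPot_const_mul_comp_add {c : ℂ} (hc : ‖c‖ = 1) (f : ℝ → ℂ) (a : ℝ) :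
    emdenPot (fun t => c * f (t + a)) = emdenPot f := by
  unfold emdenPot
  simp only [norm_mul, hc, one_mul]
  exact integral_add_right_eq_self (fun t => ‖f t‖ ^ 6) a

/-- Stability of the ground state in Emden–Fowler coordinates. -/
theorem emden_stability {ε : ℝ} (hε : 0 < ε) : ∃ δ > 0, ∀ v : ℝ → ℂ, ContDiff ℝ 1 v →
    Filter.Tendsto v Filter.atTop (nhds 0) → Filter.Tendsto v Filter.atBot (nhds 0) →
    (Integrable fun t => ‖deriv v t - v t / 2‖ ^ 2) → (Integrable fun t => ‖v t‖ ^ 6) →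
    |3 * √3 / 16 * Real.pi - emdenGrad v| < δ →
    emdenGrad v / 2 - emdenPot v / 6 ≤ (3 * √3 / 16 * Real.pi) / 3 →
    ∃ θ a : ℝ, emdenGrad (fun t => v t - Complex.exp (θ * Complex.I) * (emdenProfile (t - a) : ℂ))
      < ε := by
  obtain ⟨δ, hδ, hov⟩ := exists_overlap_lt (ε := ε / 4) (by positivity)
  refine ⟨min δ (min (ε / 2) (1 / 10)), by positivity, ?_⟩
  intro v hv htop hbot hA hB hnear hen
  have hn1 := hnear.trans_le (min_le_left _ _)
  have hn2 := hnear.trans_le ((min_le_right _ _).trans (min_le_left _ _))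
  have hn3 := hnear.trans_le ((min_le_right _ _).trans (min_le_right _ _))
  have hne : ∃ x, v x ≠ 0 := by
    by_contra! h0
    have h1 : emdenPot v = 0 := by simp [emdenPot, h0]
    have h3' : (1.7 : ℝ) ≤ √3 := Real.le_sqrt_of_sq_le (by norm_num)
    have : (1.7 : ℝ) * 3 ≤ √3 * Real.pi := mul_le_mul h3' Real.pi_gt_three.le (by norm_num) (by positivity)
    linarith [(abs_lt.mp hn3).2]
  obtain ⟨x, hx⟩ := hne
  obtain ⟨a, ha⟩ : ∃ a, ∀ t, ‖v t‖ ≤ ‖v a‖ := by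
    refine hv.continuous.norm.exists_forall_ge' x ?_
    have hx' : 0 < ‖v x‖ := norm_pos_iff.mpr hx
    rw [cocompact_eq_atBot_atTop, Filter.eventually_sup]
    exact ⟨(hbot.norm.eventually_lt_const (by simpa using hx')).mono fun _ h => h.le,
      (htop.norm.eventually_lt_const (by simpa using hx')).mono fun _ h => h.le⟩
  have hva : 0 < ‖v a‖ := (norm_pos_iff.mpr hx).trans_le (ha x)
  set θ := Complex.arg (v a)
  set c := Complex.exp (-(θ * Complex.I)) with hc
  have hc1 : ‖c‖ = 1 := by
    have : -(θ * Complex.I) = ((-θ : ℝ) : ℂ) * Complex.I := by push_cast; ring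
    rw [hc, this, Complex.norm_exp_ofReal_mul_I]
  have hcc : Complex.exp (θ * Complex.I) * c = 1 := by rw [hc, ← Complex.exp_add]; simp
  set u : ℝ → ℂ := fun t => c * v (t + a) with hu
  have hopt : IsCentredNearOptimiser u (‖v a‖ ^ 2) δ := by
    refine ⟨?_, by positivity, ?_, ?_, ?_, ?_, ?_, ?_, ?_, ?_⟩
    · exact contDiff_const.mul (hv.comp (contDiff_id.add contDiff_const))
    · intro t
      simp only [hu, norm_mul, hc1, one_mul]
      gcongr
      exact ha _
    · rw [Real.sqrt_sq hva.le]
      simp only [hu, zero_add]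
      nth_rewrite 1 [← Complex.norm_mul_exp_arg_mul_I (v a)]
      calc _ = (‖v a‖ : ℂ) * (Complex.exp (θ * Complex.I) * c) := by ring
        _ = _ := by rw [hcc, mul_one]
    · simpa using (htop.comp (Filter.tendsto_atTop_add_const_right _ a Filter.tendsto_id)).const_mul c
    · simpa using (hbot.comp (Filter.tendsto_atBot_add_const_right _ a Filter.tendsto_id)).const_mul c
    · simp only [hu, norm_grad_const_mul_comp_add, hc1, one_pow, one_mul]
      exact hA.comp_add_right a
    · simp only [hu, norm_mul, hc1, one_mul]
      exact hB.comp_add_right a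
    · rwa [emdenGrad_const_mul_comp_add hc1]
    · rwa [emdenGrad_const_mul_comp_add hc1, emdenPot_const_mul_comp_add hc1]
  refine ⟨θ, a, ?_⟩
  have heq : (fun t => v t - Complex.exp (θ * Complex.I) * (emdenProfile (t - a) : ℂ)) =
      fun t => Complex.exp (θ * Complex.I) * (fun s => u s - (emdenProfile s : ℂ)) (t + -a) := by
    funext t
    simp only [hu, mul_sub, ← mul_assoc, hcc, one_mul, ← sub_eq_add_neg, sub_add_cancel]
  have hrot := emdenGrad_const_mul_comp_add (Complex.norm_exp_ofReal_mul_I θ)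
    (fun s => u s - (emdenProfile s : ℂ)) (-a)
  rw [heq, hrot,
    emdenGrad_sub_emdenProfile hopt.contDiff hopt.le hopt.grad, emdenGrad_const_mul_comp_add hc1]
  linarith [hov u _ hopt, (abs_lt.mp hn2).1]

/-- The restriction of a function on `ℝ³` to a coordinate axis. -/
def radialProfile (f : E3 → ℂ) (r : ℝ) : ℂ := f (r • e3 0)

/-- The Emden–Fowler transform of a radial function on `ℝ³`. -/
def emden (f : E3 → ℂ) (t : ℝ) : ℂ := (Real.exp (t / 2) : ℂ) * radialProfile f (Real.exp t)

lemma norm_smul_e3 {r : ℝ} (hr : 0 ≤ r) : ‖r • e3 0‖ = r := by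
  rw [norm_smul, Real.norm_eq_abs, abs_of_nonneg hr]
  simp [e3]

lemma IsRadial.eq_radialProfile {f : E3 → ℂ} (hf : IsRadial f) (x : E3) :
    f x = radialProfile f ‖x‖ :=
  hf _ _ (norm_smul_e3 (norm_nonneg x)).symm

lemma contDiff_radialProfile {f : E3 → ℂ} (hf : ContDiff ℝ 1 f) :
    ContDiff ℝ 1 (radialProfile f) :=
  hf.comp (contDiff_id.smul contDiff_const)

lemma gradSqC_of_ne_zero {f : E3 → ℂ} (hr : IsRadial f) (hf : ContDiff ℝ 1 f) {x : E3}
    (hx : x ≠ 0) : gradSqC f x = ‖deriv (radialProfile f) ‖x‖‖ ^ 2 := by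
  have hx' : ‖x‖ ≠ 0 := norm_ne_zero_iff.mpr hx
  have h1 : HasFDerivAt (fun y : E3 => ‖y‖) _ x :=
    ((hasStrictFDerivAt_norm_sq x).hasFDerivAt.sqrt (by positivity)).congr_of_eventuallyEq
      (Filter.Eventually.of_forall fun y => by simp)
  have h2 := ((contDiff_radialProfile hf).differentiable one_ne_zero ‖x‖).hasDerivAt.hasFDerivAt.comp
    x h1
  have h3 : f = radialProfile f ∘ fun y => ‖y‖ := funext hr.eq_radialProfile
  have hp : ∀ i, pdC i f x = (x i / ‖x‖) • deriv (radialProfile f) ‖x‖ := by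
    intro i
    have h4 := h2.fderiv
    rw [← h3] at h4
    rw [pdC, h4]
    simp [e3, EuclideanSpace.inner_single_right]
    field_simp
  have hs : ∑ i, x i ^ 2 = ‖x‖ ^ 2 := by rw [EuclideanSpace.real_norm_sq_eq]
  simp only [gradSqC, hp, norm_smul, mul_pow, Real.norm_eq_abs, sq_abs, div_pow]
  rw [← Finset.sum_mul, ← Finset.sum_div, hs, div_self (by positivity), one_mul]

/-- The area of the unit sphere of `ℝ³`, written in terms of the volume of the unit ball. -/
def sphereArea : ℝ := 3 * volume.real (Metric.ball (0 : E3) 1)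

lemma sphereArea_pos : 0 < sphereArea := by
  have : 0 < volume.real (Metric.ball (0 : E3) 1) :=
    ENNReal.toReal_pos (Metric.measure_ball_pos volume _ one_pos).ne' measure_ball_lt_top.ne
  unfold sphereArea; positivity

lemma integral_norm_eq (g : ℝ → ℝ) :
    ∫ x : E3, g ‖x‖ = sphereArea * ∫ t, Real.exp t ^ 3 * g (Real.exp t) := by
  have h := integral_image_eq_integral_abs_deriv_smul MeasurableSet.univ
    (fun t _ => (Real.hasDerivAt_exp t).hasDerivWithinAt) Real.exp_injective.injOn
    (fun y => y ^ 2 • g y)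
  rw [Set.image_univ, Real.range_exp, setIntegral_univ] at h
  rw [integral_fun_norm_addHaar volume g, finrank_euclideanSpace_fin, h, sphereArea]
  simp only [smul_eq_mul, nsmul_eq_mul, Real.abs_exp]
  rw [← mul_assoc]
  congr 2
  funext t; ring

lemma integrable_norm_iff (g : ℝ → ℝ) : Integrable (fun x : E3 => g ‖x‖) ↔
    Integrable fun t => Real.exp t ^ 3 * g (Real.exp t) := by
  have h := integrableOn_image_iff_integrableOn_abs_deriv_smul MeasurableSet.univ
    (fun t _ => (Real.hasDerivAt_exp t).hasDerivWithinAt) Real.exp_injective.injOn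
    (fun y => y ^ 2 • g y)
  rw [Set.image_univ, Real.range_exp, integrableOn_univ] at h
  rw [integrable_fun_norm_addHaar volume, finrank_euclideanSpace_fin, h]
  simp only [smul_eq_mul, Real.abs_exp]
  refine integrable_congr (Filter.Eventually.of_forall fun t => ?_)
  simp only; ring

lemma contDiff_emden {f : E3 → ℂ} (hf : ContDiff ℝ 1 f) : ContDiff ℝ 1 (emden f) :=
  (Complex.ofRealCLM.contDiff.comp (Real.contDiff_exp.comp (contDiff_id.div_const 2))).mul
    ((contDiff_radialProfile hf).comp Real.contDiff_exp)

lemma deriv_emden_sub {f : E3 → ℂ} (hf : ContDiff ℝ 1 f) (t : ℝ) :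
    deriv (emden f) t - emden f t / 2 =
      (Real.exp (t / 2) * Real.exp t) • deriv (radialProfile f) (Real.exp t) := by
  have h1 := ((contDiff_radialProfile hf).differentiable one_ne_zero
    (Real.exp t)).hasDerivAt.scomp t (Real.hasDerivAt_exp t)
  have h2 := (((hasDerivAt_id t).div_const 2).exp.ofReal_comp).mul h1
  have h3 : HasDerivAt (emden f) _ t := h2
  rw [h3.deriv, emden]
  simp
  ring

lemma exp_half_sq (t : ℝ) : Real.exp (t / 2) ^ 2 = Real.exp t := by
  rw [← Real.exp_nat_mul]; congr 1; push_cast; ring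

lemma norm_deriv_emden_sub_sq {f : E3 → ℂ} (hf : ContDiff ℝ 1 f) (t : ℝ) :
    ‖deriv (emden f) t - emden f t / 2‖ ^ 2 =
      Real.exp t ^ 3 * ‖deriv (radialProfile f) (Real.exp t)‖ ^ 2 := by
  rw [deriv_emden_sub hf, norm_smul, mul_pow, Real.norm_eq_abs, sq_abs, mul_pow, exp_half_sq]
  ring

lemma norm_emden_pow_six (f : E3 → ℂ) (t : ℝ) :
    ‖emden f t‖ ^ 6 = Real.exp t ^ 3 * ‖radialProfile f (Real.exp t)‖ ^ 6 := by
  rw [emden, norm_mul, mul_pow, Complex.norm_real, Real.norm_eq_abs, Real.abs_exp,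
    show Real.exp (t / 2) ^ 6 = (Real.exp (t / 2) ^ 2) ^ 3 by ring, exp_half_sq]

lemma gradSqC_ae_eq {f : E3 → ℂ} (hr : IsRadial f) (hf : ContDiff ℝ 1 f) :
    gradSqC f =ᵐ[volume] fun x => ‖deriv (radialProfile f) ‖x‖‖ ^ 2 := by
  filter_upwards [compl_mem_ae_iff.mpr (measure_singleton (0 : E3))] with x hx
  exact gradSqC_of_ne_zero hr hf hx

lemma integral_gradSqC {f : E3 → ℂ} (hr : IsRadial f) (hf : ContDiff ℝ 1 f) :
    ∫ x, gradSqC f x = sphereArea * emdenGrad (emden f) := by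
  rw [integral_congr_ae (gradSqC_ae_eq hr hf),
    integral_norm_eq fun r => ‖deriv (radialProfile f) r‖ ^ 2]
  simp only [emdenGrad, norm_deriv_emden_sub_sq hf]

lemma integrable_gradSqC_iff {f : E3 → ℂ} (hr : IsRadial f) (hf : ContDiff ℝ 1 f) :
    Integrable (gradSqC f) ↔ Integrable fun t => ‖deriv (emden f) t - emden f t / 2‖ ^ 2 := by
  rw [integrable_congr (gradSqC_ae_eq hr hf),
    integrable_norm_iff fun r => ‖deriv (radialProfile f) r‖ ^ 2]
  simp only [norm_deriv_emden_sub_sq hf]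

lemma integral_norm_pow_six {f : E3 → ℂ} (hr : IsRadial f) :
    ∫ x, ‖f x‖ ^ 6 = sphereArea * emdenPot (emden f) := by
  simp only [hr.eq_radialProfile]
  rw [integral_norm_eq fun r => ‖radialProfile f r‖ ^ 6]
  simp only [emdenPot, norm_emden_pow_six]

lemma integrable_norm_pow_six_iff {f : E3 → ℂ} (hr : IsRadial f) :
    Integrable (fun x => ‖f x‖ ^ 6) ↔ Integrable fun t => ‖emden f t‖ ^ 6 := by
  simp only [hr.eq_radialProfile]
  rw [integrable_norm_iff fun r => ‖radialProfile f r‖ ^ 6]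
  simp only [norm_emden_pow_six]

lemma Ecrit_eq {f : E3 → ℂ} (hr : IsRadial f) (hf : ContDiff ℝ 1 f)
    (h6 : Integrable fun x => ‖f x‖ ^ 6) (hg : Integrable (gradSqC f)) :
    Ecrit f = sphereArea * (emdenGrad (emden f) / 2 - emdenPot (emden f) / 6) := by
  rw [Ecrit, integral_sub (hg.const_mul _) (h6.const_mul _), integral_const_mul,
    integral_const_mul, integral_gradSqC hr hf, integral_norm_pow_six hr]
  ring

/-- Finite energy forces decay at `+∞` in Emden–Fowler coordinates. -/
lemma tendsto_atTop_zero_of_finite_energy {v : ℝ → ℂ} (hv : ContDiff ℝ 1 v)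
    (hA : Integrable fun t => ‖deriv v t - v t / 2‖ ^ 2) (hP : Integrable fun t => ‖v t‖ ^ 6) :
    Filter.Tendsto v Filter.atTop (nhds 0) := by
  have hvc := hv.continuous
  have hdc : Continuous (deriv v) := hv.continuous_deriv le_rfl
  have hH : Integrable fun t => ‖v t‖ ^ 6 + ‖deriv v t - v t / 2‖ ^ 2 := hP.add hA
  have hd : ∀ r, HasDerivAt (fun r => Real.exp (-2 * r) * (‖v r‖ ^ 2) ^ 2)
      (4 * Real.exp (-2 * r) * ‖v r‖ ^ 2 * inner ℝ (v r) (deriv v r - v r / 2)) r := by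
    intro r
    have h1 := ((hasDerivAt_id r).const_mul (-2)).exp.mul
      (((hv.differentiable one_ne_zero r).hasDerivAt.norm_sq).pow 2)
    refine h1.congr_deriv ?_
    have : v r / 2 = (1 / 2 : ℝ) • v r := by
      rw [Complex.real_smul]; push_cast; ring
    rw [this, inner_sub_right, inner_smul_right, real_inner_self_eq_norm_sq]
    simp
    ring
  have hb : ∀ t r, t ≤ r → -(2 * Real.exp (-2 * t) * (‖v r‖ ^ 6 + ‖deriv v r - v r / 2‖ ^ 2)) ≤
      4 * Real.exp (-2 * r) * ‖v r‖ ^ 2 * inner ℝ (v r) (deriv v r - v r / 2) := by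
    intro t r htr
    have h1 := abs_real_inner_le_norm (v r) (deriv v r - v r / 2)
    have h2 := (abs_le.mp h1).1
    have h3 : Real.exp (-2 * r) ≤ Real.exp (-2 * t) := Real.exp_le_exp.mpr (by linarith)
    have h4 := Real.exp_pos (-2 * r)
    set p := ‖v r‖
    set q := ‖deriv v r - v r / 2‖
    have h5 : -(p ^ 6 + q ^ 2) ≤ 2 * (p ^ 2 * -(p * q)) := by nlinarith [sq_nonneg (p ^ 3 - q)]
    calc -(2 * Real.exp (-2 * t) * (p ^ 6 + q ^ 2))
        ≤ -(2 * Real.exp (-2 * r) * (p ^ 6 + q ^ 2)) := by gcongr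
      _ = 2 * Real.exp (-2 * r) * -(p ^ 6 + q ^ 2) := by ring
      _ ≤ 2 * Real.exp (-2 * r) * (2 * (p ^ 2 * -(p * q))) := by gcongr
      _ ≤ 2 * Real.exp (-2 * r) * (2 * (p ^ 2 * inner ℝ (v r) (deriv v r - v r / 2))) := by gcongr
      _ = _ := by ring
  have hsmall : ∀ t, ∀ η > 0, ∃ s, t ≤ s ∧ ‖v s‖ < η := by
    intro t η hη
    by_contra! hcon
    have : IntegrableOn (fun _ : ℝ => η ^ 6) (Set.Ioi t) := by
      refine hP.integrableOn.mono' aestronglyMeasurable_const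
        ((ae_restrict_mem measurableSet_Ioi).mono fun s hs => ?_)
      rw [Real.norm_eq_abs, abs_of_pos (by positivity)]
      exact pow_le_pow_left₀ hη.le (hcon s (le_of_lt hs)) 6
    rw [integrableOn_const_iff] at this
    simp [hη.ne'] at this
  have hmain : ∀ t, ‖v t‖ ^ 4 ≤
      2 * ∫ s in Set.Ioi t, ‖v s‖ ^ 6 + ‖deriv v s - v s / 2‖ ^ 2 := by
    intro t
    refine le_of_forall_pos_le_add fun η hη => ?_
    obtain ⟨s, hts, hs⟩ := hsmall t (min η 1) (by positivity)
    have hs4 : ‖v s‖ ^ 4 ≤ η := by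
      have h1 : ‖v s‖ ≤ 1 := hs.le.trans (min_le_right _ _)
      calc ‖v s‖ ^ 4 ≤ ‖v s‖ := pow_le_of_le_one (norm_nonneg _) h1 (by norm_num)
        _ ≤ η := hs.le.trans (min_le_left _ _)
    have hdcont : Continuous fun r => 4 * Real.exp (-2 * r) * ‖v r‖ ^ 2 *
        inner ℝ (v r) (deriv v r - v r / 2) := by fun_prop
    have h1 := intervalIntegral.integral_eq_sub_of_hasDerivAt (a := t) (b := s)
      (fun r _ => hd r) (hdcont.intervalIntegrable _ _)
    have h2 := intervalIntegral.integral_mono_on hts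
      ((hH.const_mul (2 * Real.exp (-2 * t))).neg.intervalIntegrable)
      (hdcont.intervalIntegrable _ _) (fun r hr => hb t r hr.1)
    simp only [Pi.neg_apply] at h2
    rw [h1, intervalIntegral.integral_neg, intervalIntegral.integral_const_mul,
      intervalIntegral.integral_of_le hts] at h2
    have h3 : ∫ r in Set.Ioc t s, ‖v r‖ ^ 6 + ‖deriv v r - v r / 2‖ ^ 2 ≤
        ∫ r in Set.Ioi t, ‖v r‖ ^ 6 + ‖deriv v r - v r / 2‖ ^ 2 :=
      setIntegral_mono_set hH.integrableOn (Filter.Eventually.of_forall fun r => by positivity)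
        (Filter.Eventually.of_forall Set.Ioc_subset_Ioi_self)
    have h4 : Real.exp (-2 * s) ≤ Real.exp (-2 * t) := Real.exp_le_exp.mpr (by linarith)
    have h5 : Real.exp (-2 * s) * (‖v s‖ ^ 2) ^ 2 ≤ Real.exp (-2 * t) * η := by
      rw [← pow_mul]; gcongr
    have h6 := Real.exp_pos (-2 * t)
    refine le_of_mul_le_mul_left ?_ h6
    have h7 := mul_le_mul_of_nonneg_left h3 h6.le
    simp only [← pow_mul, Nat.reduceMul] at h2 h5
    linarith
  have hz : Filter.Tendsto (fun t => ‖v t‖ ^ 4) Filter.atTop (nhds 0) := by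
    refine squeeze_zero (fun t => by positivity) hmain ?_
    simpa using (tendsto_integral_Ioi_zero (μ := volume)
      (f := fun s => ‖v s‖ ^ 6 + ‖deriv v s - v s / 2‖ ^ 2) Filter.tendsto_id).const_mul 2
  rw [tendsto_zero_iff_norm_tendsto_zero]
  have := hz.sqrt.sqrt
  simp only [Real.sqrt_zero] at this
  refine this.congr fun t => ?_
  rw [show ‖v t‖ ^ 4 = (‖v t‖ ^ 2) ^ 2 by ring, Real.sqrt_sq (by positivity),
    Real.sqrt_sq (norm_nonneg _)]

lemma tendsto_emden_atBot {f : E3 → ℂ} (hf : ContDiff ℝ 1 f) :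
    Filter.Tendsto (emden f) Filter.atBot (nhds 0) := by
  have h1 := ((contDiff_radialProfile hf).continuous.tendsto 0).comp Real.tendsto_exp_atBot
  have h2 : Filter.Tendsto (fun t : ℝ => (Real.exp (t / 2) : ℂ)) Filter.atBot (nhds (0 : ℝ)) :=
    (Complex.continuous_ofReal.tendsto 0).comp
      (Real.tendsto_exp_atBot.comp (Filter.tendsto_id.atBot_div_const two_pos))
  have h3 := h2.mul h1
  rwa [Complex.ofReal_zero, zero_mul] at h3

lemma contDiff_W : ContDiff ℝ 1 W := by
  refine ContDiff.rpow_const_of_ne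
    (contDiff_const.add ((contDiff_norm_sq ℝ).div_const 3)) fun x => ?_
  positivity

lemma gradSqC_Wc (x : E3) : gradSqC Wc x = gradSqR W x := by
  have h : ∀ i, pdC i Wc x = (pdR i W x : ℂ) := by
    intro i
    have := Complex.ofRealCLM.hasFDerivAt.comp x
      (contDiff_W.differentiable one_ne_zero x).hasFDerivAt
    have h2 : HasFDerivAt Wc _ x := this
    rw [pdC, pdR, h2.fderiv]
    rfl
  simp only [gradSqC, gradSqR, h, Complex.norm_real, Real.norm_eq_abs, sq_abs]

lemma isRadial_groundC (θ μ : ℝ) : IsRadial (groundC θ μ) := by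
  intro x y h
  simp only [groundC, W, norm_smul, h]

lemma contDiff_groundC (θ μ : ℝ) : ContDiff ℝ 1 (groundC θ μ) :=
  contDiff_const.mul (Complex.ofRealCLM.contDiff.comp
    (contDiff_W.comp (contDiff_const_smul μ)))

lemma sqrt_mul_W (a t : ℝ) : Real.exp (t / 2) * (√(√3 * Real.exp (-a)) *
    W ((√3 * Real.exp (-a)) • Real.exp t • e3 0)) = emdenProfile (t - a) := by
  have h1 : ‖(√3 * Real.exp (-a)) • Real.exp t • e3 0‖ = √3 * Real.exp (t - a) := by
    rw [smul_smul, norm_smul_e3 (by positivity), sub_eq_add_neg, Real.exp_add]; ring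
  have h2 : Real.exp (t / 2) = √(Real.exp t) := by
    rw [← exp_half_sq t, Real.sqrt_sq (Real.exp_pos _).le]
  rw [W, h1, mul_pow, Real.sq_sqrt (by norm_num), h2, neg_div, Real.rpow_neg (by positivity),
    ← Real.sqrt_eq_rpow, ← Real.sqrt_inv, ← Real.sqrt_mul (by positivity),
    ← Real.sqrt_mul (by positivity), emdenProfile, Real.cosh_eq]
  congr 1
  rw [Real.exp_neg (t - a), Real.exp_sub, Real.exp_neg]
  have := Real.exp_pos t
  have := Real.exp_pos a
  field_simp
  ring

lemma emden_groundC (θ a : ℝ) : emden (groundC θ (√3 * Real.exp (-a))) =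
    fun t => Complex.exp (θ * Complex.I) * (emdenProfile (t - a) : ℂ) := by
  funext t
  rw [emden, radialProfile, groundC, ← sqrt_mul_W]
  push_cast
  ring

lemma emden_sub (f g : E3 → ℂ) :
    emden (fun x => f x - g x) = fun t => emden f t - emden g t := by
  funext t
  simp only [emden, radialProfile, mul_sub]

lemma Wc_eq_groundC : Wc = groundC 0 (√3 * Real.exp (-Real.log √3)) := by
  have h : √3 * Real.exp (-Real.log √3) = 1 := by
    rw [Real.exp_neg, Real.exp_log (by positivity), mul_inv_cancel₀ (by positivity)]
  rw [h]
  funext x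
  simp [Wc, groundC]

lemma isRadial_Wc : IsRadial Wc := Wc_eq_groundC ▸ isRadial_groundC _ _

lemma contDiff_Wc : ContDiff ℝ 1 Wc := Wc_eq_groundC ▸ contDiff_groundC _ _

lemma emden_Wc : emden Wc = fun t => 1 * (emdenProfile (t + -Real.log √3) : ℂ) := by
  rw [Wc_eq_groundC, emden_groundC]
  simp [sub_eq_add_neg]

lemma emdenGrad_Wc : emdenGrad (emden Wc) = 3 * √3 / 16 * Real.pi := by
  rw [emden_Wc, ← emdenGrad_emdenProfile]
  exact emdenGrad_const_mul_comp_add norm_one (fun t => (emdenProfile t : ℂ)) _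

lemma emdenPot_Wc : emdenPot (emden Wc) = 3 * √3 / 16 * Real.pi := by
  rw [emden_Wc, ← emdenPot_emdenProfile]
  exact emdenPot_const_mul_comp_add norm_one (fun t => (emdenProfile t : ℂ)) _

lemma integrable_Wc_pow_six : Integrable fun x => ‖Wc x‖ ^ 6 := by
  rw [integrable_norm_pow_six_iff isRadial_Wc, emden_Wc]
  refine ((integrable_emdenProfile_pow (n := 6) (by norm_num)).comp_add_right
    (-Real.log √3)).congr (Filter.Eventually.of_forall fun t => ?_)
  simp [(Even.pow_abs (by decide : Even 6))]

lemma integrable_gradSqC_Wc : Integrable (gradSqC Wc) := by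
  rw [integrable_gradSqC_iff isRadial_Wc contDiff_Wc, emden_Wc]
  refine (integrable_emdenProfileGrad_sq.comp_add_right
    (-Real.log √3)).congr (Filter.Eventually.of_forall fun t => ?_)
  beta_reduce
  rw [norm_grad_const_mul_comp_add 1 (fun t => (emdenProfile t : ℂ)), deriv_emdenProfile_sub]
  simp

lemma Ecrit_Wc : Ecrit Wc = sphereArea * ((3 * √3 / 16 * Real.pi) / 3) := by
  rw [Ecrit_eq isRadial_Wc contDiff_Wc integrable_Wc_pow_six integrable_gradSqC_Wc,
    emdenGrad_Wc, emdenPot_Wc]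
  ring

/-- Near the threshold, radial functions with subcritical energy are close to the
ground-state orbit. -/
theorem proximity_to_ground_state_orbit :
    ∀ ε > (0:ℝ), ∃ δ₀ > (0:ℝ), ∀ f : E3 → ℂ, IsRadial f → ContDiff ℝ 1 f →
      Integrable (fun x : E3 => ‖f x‖ ^ 6) → Integrable (gradSqC f) →
      Ecrit f ≤ Ecrit Wc →
      |(∫ x : E3, gradSqR W x) - ∫ x : E3, gradSqC f x| < δ₀ →
      ∃ (θ μ : ℝ), 0 < μ ∧
        Real.sqrt (∫ x : E3, gradSqC (fun x => f x - groundC θ μ x) x) < ε := by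
  intro ε hε
  have hc := sphereArea_pos
  obtain ⟨δ, hδ, hstab⟩ := emden_stability (ε := ε ^ 2 / sphereArea) (by positivity)
  refine ⟨sphereArea * δ, by positivity, fun f hr hf h6 hg hE hgap => ?_⟩
  have hA := (integrable_gradSqC_iff hr hf).mp hg
  have hP := (integrable_norm_pow_six_iff hr).mp h6
  have hgap' : |3 * √3 / 16 * Real.pi - emdenGrad (emden f)| < δ := by
    simp only [← gradSqC_Wc] at hgap
    rw [integral_gradSqC isRadial_Wc contDiff_Wc, integral_gradSqC hr hf, emdenGrad_Wc, ← mul_sub,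
      abs_mul, abs_of_pos hc] at hgap
    exact lt_of_mul_lt_mul_left hgap hc.le
  rw [Ecrit_Wc, Ecrit_eq hr hf h6 hg] at hE
  obtain ⟨θ, a, h⟩ := hstab (emden f) (contDiff_emden hf)
    (tendsto_atTop_zero_of_finite_energy (contDiff_emden hf) hA hP) (tendsto_emden_atBot hf) hA hP
    hgap' (le_of_mul_le_mul_left hE hc)
  refine ⟨θ, √3 * Real.exp (-a), by positivity, ?_⟩
  have hr' : IsRadial fun x => f x - groundC θ (√3 * Real.exp (-a)) x := fun x y hxy => by
    simp only [hr x y hxy, isRadial_groundC θ (√3 * Real.exp (-a)) x y hxy]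
  rw [integral_gradSqC hr' (hf.sub (contDiff_groundC _ _)), emden_sub, emden_groundC,
    Real.sqrt_lt' hε, mul_comm]
  exact (lt_div_iff₀ hc).mp h
end
end

section
/- Existence of modulation parameters with orthogonality: there exist δ₀ > 0 and C > 0 such that for every radial, continuously differentiable f : ℝ³ → ℂ with f ∈ L⁶(ℝ³), ∇f ∈ L²(ℝ³), and ε := inf over θ ∈ ℝ, μ > 0 of ‖∇( f − e^{iθ} μ^{1/2} W(μ·) )‖_{L²} satisfying ε < δ₀, there exist θ ∈ ℝ and μ > 0 such that g := e^{−iθ} f − μ^{1/2} W(μ·) satisfies ‖∇g‖_{L²} ≤ C ε together with the orthogonality conditions ∫_{ℝ³} ∇(Im g)·∇( μ^{1/2} W(μ·) ) dx = 0 and ∫_{ℝ³} ∇(Re g)·∇( μ^{1/2} W₁(μ·) ) dx = 0. -/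
open MeasureTheory Complex
open scoped BigOperators ENNReal

noncomputable section

/-- `W₁ = ½W + x·∇W`. -/
def W1 (x : E3) : ℝ := (1:ℝ)/2 * W x + fderiv ℝ W x x

/-- The modulation remainder `g = e^{-iθ} f - μ^{1/2} W(μ·)`. -/
def modG (f : E3 → ℂ) (θ μ : ℝ) (x : E3) : ℂ :=
  Complex.exp (-θ * Complex.I) * f x - ((Real.sqrt μ * W (μ • x) : ℝ) : ℂ)

/-- The profile `W(μx)`, as an inverse square root. -/
def scaledW (μ : ℝ) (x : E3) : ℝ := (√(1 + μ ^ 2 * ‖x‖ ^ 2 / 3))⁻¹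

/-- The scalar `a` with `∇(μ^{1/2} W(μ·))(x) = a x`. -/
def gradCoeff (μ : ℝ) (x : E3) : ℝ := -(1 / 3) * (√μ * μ ^ 2) * scaledW μ x ^ 3

/-- The scalar `b` with `∇(μ^{1/2} W₁(μ·))(x) = b x`. -/
def gradCoeff₁ (μ : ℝ) (x : E3) : ℝ :=
  √μ * μ ^ 2 * (scaledW μ x ^ 3 / 6 - scaledW μ x ^ 5)

lemma scaledW_pos (μ : ℝ) (x : E3) : 0 < scaledW μ x := by
  unfold scaledW; positivity

lemma scaledW_sq_mul (μ : ℝ) (x : E3) :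
    scaledW μ x ^ 2 * (1 + μ ^ 2 * ‖x‖ ^ 2 / 3) = 1 := by
  unfold scaledW
  rw [inv_pow, Real.sq_sqrt (by positivity)]
  exact inv_mul_cancel₀ (by positivity)

lemma scaledW_le_one (μ : ℝ) (x : E3) : scaledW μ x ≤ 1 := by
  unfold scaledW
  apply inv_le_one_of_one_le₀
  rw [Real.one_le_sqrt]
  have : 0 ≤ μ ^ 2 * ‖x‖ ^ 2 / 3 := by positivity
  linarith

lemma scaledW_anti {a b : ℝ} (ha : 0 ≤ a) (hab : a ≤ b) (x : E3) :
    scaledW b x ≤ scaledW a x := by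
  unfold scaledW
  gcongr

lemma scaledW_eq_comp_smul (μ : ℝ) (x : E3) : scaledW μ x = scaledW 1 (μ • x) := by
  simp [scaledW, norm_smul, mul_pow]

lemma continuous_scaledW (μ : ℝ) : Continuous (scaledW μ) := by
  unfold scaledW
  exact Continuous.inv₀ (by fun_prop) fun x => by positivity

lemma continuous_gradCoeff (μ : ℝ) : Continuous (gradCoeff μ) := by
  have := continuous_scaledW μ
  unfold gradCoeff
  fun_prop

lemma continuous_gradCoeff₁ (μ : ℝ) : Continuous (gradCoeff₁ μ) := by
  have := continuous_scaledW μ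
  unfold gradCoeff₁
  fun_prop

lemma W_smul (μ : ℝ) (x : E3) : W (μ • x) = scaledW μ x := by
  unfold W scaledW
  rw [neg_div, Real.rpow_neg (by positivity), Real.sqrt_eq_rpow, norm_smul, mul_pow]
  simp

/-- The chain rule for a function of `‖x‖²`. -/
lemma hasFDerivAt_comp_norm_sq {φ : ℝ → ℝ} {d : ℝ} {x : E3} (h : HasDerivAt φ d (‖x‖ ^ 2)) :
    HasFDerivAt (fun y : E3 => φ (‖y‖ ^ 2)) ((2 * d) • innerSL ℝ x) x := by
  have := h.comp_hasFDerivAt x (hasStrictFDerivAt_norm_sq x).hasFDerivAt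
  refine this.congr_fderiv ?_
  ext v
  simp
  ring

lemma hasDerivAt_inv_sqrt {c s : ℝ} (hs : 0 < 1 + c * s / 3) :
    HasDerivAt (fun t => (√(1 + c * t / 3))⁻¹)
      (-(c / 6) * (√(1 + c * s / 3))⁻¹ ^ 3) s := by
  have h1 : HasDerivAt (fun t => 1 + c * t / 3) (c / 3) s := by
    simpa using (((hasDerivAt_id s).const_mul c).div_const 3).const_add 1
  have h2 := (h1.sqrt hs.ne').fun_inv (Real.sqrt_pos.2 hs).ne'
  refine h2.congr_deriv ?_
  have : √(1 + c * s / 3) ≠ 0 := (Real.sqrt_pos.2 hs).ne'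
  field_simp
  ring

lemma hasFDerivAt_scaledW (μ : ℝ) (x : E3) :
    HasFDerivAt (scaledW μ) ((-(μ ^ 2 / 3) * scaledW μ x ^ 3) • innerSL ℝ x) x := by
  have := hasFDerivAt_comp_norm_sq (x := x)
    (hasDerivAt_inv_sqrt (c := μ ^ 2) (s := ‖x‖ ^ 2) (by positivity))
  refine this.congr_fderiv ?_
  unfold scaledW
  congr 1
  ring

lemma hasFDerivAt_rescaledW (μ : ℝ) (x : E3) :
    HasFDerivAt (fun y => √μ * W (μ • y)) (gradCoeff μ x • innerSL ℝ x) x := by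
  simp only [W_smul]
  refine ((hasFDerivAt_scaledW μ x).const_mul √μ).congr_fderiv ?_
  rw [smul_smul]
  congr 1
  unfold gradCoeff
  ring

lemma W1_smul (μ : ℝ) (x : E3) :
    W1 (μ • x) = scaledW μ x ^ 3 - 1 / 2 * scaledW μ x := by
  have hW : W = scaledW 1 := by
    ext y
    simpa using W_smul 1 y
  rw [W1, hW, (hasFDerivAt_scaledW 1 (μ • x)).fderiv, ← scaledW_eq_comp_smul]
  have h := scaledW_sq_mul μ x
  simp only [smul_apply, innerSL_apply_apply, real_inner_self_eq_norm_sq,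
    norm_smul, mul_pow, smul_eq_mul, Real.norm_eq_abs, sq_abs]
  linear_combination (-scaledW μ x) * h

lemma hasFDerivAt_rescaledW1 (μ : ℝ) (x : E3) :
    HasFDerivAt (fun y => √μ * W1 (μ • y)) (gradCoeff₁ μ x • innerSL ℝ x) x := by
  simp only [W1_smul]
  have h := hasFDerivAt_scaledW μ x
  refine (((h.pow 3).sub (h.const_mul (1 / 2))).const_mul √μ).congr_fderiv ?_
  ext v
  simp [gradCoeff₁]
  ring

lemma hasDerivAt_gradCoeff {μ : ℝ} (hμ : 0 < μ) (x : E3) :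
    HasDerivAt (fun ν => gradCoeff ν x) (μ⁻¹ * gradCoeff₁ μ x) μ := by
  have h1 : HasDerivAt (fun ν : ℝ => (√(1 + ‖x‖ ^ 2 * ν ^ 2 / 3))⁻¹) _ μ :=
    HasDerivAt.comp (h₂ := fun t => (√(1 + ‖x‖ ^ 2 * t / 3))⁻¹) μ
      (hasDerivAt_inv_sqrt (c := ‖x‖ ^ 2) (s := μ ^ 2) (by positivity)) (hasDerivAt_pow 2 μ)
  have h2 : HasDerivAt (fun ν => scaledW ν x) (-(‖x‖ ^ 2 * μ / 3) * scaledW μ x ^ 3) μ := by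
    convert h1 using 1
    · ext ν
      simp [scaledW, mul_comm]
    · rw [scaledW, mul_comm (‖x‖ ^ 2) (μ ^ 2)]
      push_cast
      ring
  have h3 := (((Real.hasDerivAt_sqrt hμ.ne').mul (hasDerivAt_pow 2 μ)).const_mul
    (-(1 / 3))).mul (h2.pow 3)
  refine h3.congr_deriv ?_
  have h := scaledW_sq_mul μ x
  have hm : √μ ≠ 0 := (Real.sqrt_pos.2 hμ).ne'
  have hmm : μ = √μ ^ 2 := (Real.sq_sqrt hμ.le).symm
  unfold gradCoeff₁
  simp only [Pi.mul_apply, Pi.pow_apply]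
  generalize scaledW μ x = u at *
  generalize √μ = m at *
  subst hmm
  field_simp
  push_cast
  field_simp
  linear_combination 36 * u ^ 3 * h

lemma gradCoeff_sq_le (μ : ℝ) (hμ : 0 < μ) (x : E3) :
    gradCoeff μ x ^ 2 * ‖x‖ ^ 2 ≤ 3 * μ ^ 3 * scaledW μ x ^ 4 := by
  have h := scaledW_sq_mul μ x
  have hu := scaledW_pos μ x
  have e : gradCoeff μ x ^ 2 * ‖x‖ ^ 2
      = (√μ ^ 2) * μ ^ 2 / 9 * scaledW μ x ^ 4 * (scaledW μ x ^ 2 * (μ ^ 2 * ‖x‖ ^ 2)) := by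
    unfold gradCoeff; ring
  have : scaledW μ x ^ 2 * (μ ^ 2 * ‖x‖ ^ 2) ≤ 3 := by nlinarith [sq_nonneg (scaledW μ x)]
  rw [e, Real.sq_sqrt hμ.le]
  calc _ ≤ μ * μ ^ 2 / 9 * scaledW μ x ^ 4 * 3 := by gcongr
    _ ≤ _ := by
      have : 0 ≤ μ ^ 3 * scaledW μ x ^ 4 := by positivity
      nlinarith

lemma gradCoeff₁_sq_le (μ : ℝ) (hμ : 0 < μ) (x : E3) :
    gradCoeff₁ μ x ^ 2 * ‖x‖ ^ 2 ≤ 3 * μ ^ 3 * scaledW μ x ^ 4 := by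
  have h := scaledW_sq_mul μ x
  have hu := scaledW_pos μ x
  have hu1 : scaledW μ x ^ 2 ≤ 1 := pow_le_one₀ hu.le (scaledW_le_one μ x)
  have e : gradCoeff₁ μ x ^ 2 * ‖x‖ ^ 2
      = (√μ ^ 2) * μ ^ 2 * scaledW μ x ^ 4 * (1 / 6 - scaledW μ x ^ 2) ^ 2
        * (scaledW μ x ^ 2 * (μ ^ 2 * ‖x‖ ^ 2)) := by
    unfold gradCoeff₁; ring
  have : scaledW μ x ^ 2 * (μ ^ 2 * ‖x‖ ^ 2) ≤ 3 := by nlinarith [sq_nonneg (scaledW μ x)]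
  have h2 : (1 / 6 - scaledW μ x ^ 2) ^ 2 ≤ 1 := by nlinarith [sq_nonneg (scaledW μ x)]
  rw [e, Real.sq_sqrt hμ.le]
  calc _ ≤ μ * μ ^ 2 * scaledW μ x ^ 4 * 1 * 3 := by gcongr
    _ = _ := by ring

lemma integrable_scaledW_one_pow_mul_sqrt :
    Integrable (fun x : E3 => scaledW 1 x ^ 3 * √(scaledW 1 x)) := by
  have h := (integrable_rpow_neg_one_add_norm_sq (E := E3) (μ := volume) (r := 7 / 2)
    (by norm_num)).const_mul ((3 : ℝ) ^ (7 / 4 : ℝ))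
  refine h.mono' ?_ (.of_forall fun x => ?_)
  · exact (((continuous_scaledW 1).pow 3).mul (continuous_scaledW 1).sqrt).aestronglyMeasurable
  · have hu := scaledW_pos 1 x
    have hs := scaledW_sq_mul 1 x
    have e : scaledW 1 x ^ 3 * √(scaledW 1 x) = (scaledW 1 x ^ 2) ^ (7 / 4 : ℝ) := by
      rw [Real.sqrt_eq_rpow, ← Real.rpow_natCast, ← Real.rpow_natCast, ← Real.rpow_mul hu.le,
        ← Real.rpow_add hu]
      norm_num
    have hx : (0 : ℝ) < 1 + ‖x‖ ^ 2 := by positivity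
    rw [Real.norm_of_nonneg (by positivity), e, show (-(7 / 2 : ℝ) / 2) = -(7 / 4) by norm_num,
      Real.rpow_neg hx.le, ← Real.inv_rpow hx.le, ← Real.mul_rpow (by norm_num) (by positivity)]
    refine Real.rpow_le_rpow (by positivity) ?_ (by norm_num)
    rw [← div_eq_mul_inv, le_div_iff₀ hx]
    nlinarith [sq_nonneg (scaledW 1 x)]

lemma integral_comp_smul_E3 {μ : ℝ} (hμ : 0 < μ) (g : E3 → ℝ) :
    ∫ x, μ ^ 3 * g (μ • x) = ∫ x, g x := by
  rw [integral_const_mul, Measure.integral_comp_smul, finrank_euclideanSpace_fin, smul_eq_mul,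
    abs_of_pos (by positivity), ← mul_assoc, mul_inv_cancel₀ (by positivity), one_mul]

lemma integrable_scaledW_pow_mul_sqrt {μ : ℝ} (hμ : 0 < μ) :
    Integrable (fun x : E3 => scaledW μ x ^ 3 * √(scaledW μ x)) := by
  simpa only [← scaledW_eq_comp_smul] using
    integrable_scaledW_one_pow_mul_sqrt.comp_smul hμ.ne'

lemma integrable_scaledW_pow_four {μ : ℝ} (hμ : 0 < μ) :
    Integrable (fun x : E3 => scaledW μ x ^ 4) := by
  refine (integrable_scaledW_pow_mul_sqrt hμ).mono'
    ((continuous_scaledW μ).pow 4).aestronglyMeasurable (.of_forall fun x => ?_)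
  have hu := scaledW_pos μ x
  have : scaledW μ x ≤ √(scaledW μ x) := Real.le_sqrt_of_sq_le (by nlinarith [scaledW_le_one μ x])
  rw [Real.norm_of_nonneg (by positivity), pow_succ]
  gcongr

lemma integrable_gradCoeff_sq {μ : ℝ} (hμ : 0 < μ) :
    Integrable (fun x : E3 => gradCoeff μ x ^ 2 * ‖x‖ ^ 2) := by
  refine ((integrable_scaledW_pow_four hμ).const_mul (3 * μ ^ 3)).mono'
    (((continuous_gradCoeff μ).pow 2).mul (continuous_norm.pow 2)).aestronglyMeasurable
    (.of_forall fun x => ?_)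
  rw [Real.norm_of_nonneg (by positivity)]
  exact gradCoeff_sq_le μ hμ x

lemma integrable_gradCoeff₁_sq {μ : ℝ} (hμ : 0 < μ) :
    Integrable (fun x : E3 => gradCoeff₁ μ x ^ 2 * ‖x‖ ^ 2) := by
  refine ((integrable_scaledW_pow_four hμ).const_mul (3 * μ ^ 3)).mono'
    (((continuous_gradCoeff₁ μ).pow 2).mul (continuous_norm.pow 2)).aestronglyMeasurable
    (.of_forall fun x => ?_)
  rw [Real.norm_of_nonneg (by positivity)]
  exact gradCoeff₁_sq_le μ hμ x

lemma integral_gradCoeff_sq {μ : ℝ} (hμ : 0 < μ) :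
    ∫ x : E3, gradCoeff μ x ^ 2 * ‖x‖ ^ 2 = ∫ x : E3, gradCoeff 1 x ^ 2 * ‖x‖ ^ 2 := by
  rw [← integral_comp_smul_E3 hμ fun x => gradCoeff 1 x ^ 2 * ‖x‖ ^ 2]
  congr 1 with x
  simp only [gradCoeff, ← scaledW_eq_comp_smul, norm_smul, mul_pow, Real.norm_eq_abs, sq_abs,
    Real.sq_sqrt hμ.le]
  simp
  ring

lemma integral_gradCoeff_one_sq_pos : 0 < ∫ x : E3, gradCoeff 1 x ^ 2 * ‖x‖ ^ 2 := by
  rw [integral_pos_iff_support_of_nonneg (fun x => by positivity)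
    (integrable_gradCoeff_sq one_pos)]
  refine IsOpen.measure_pos _ ?_ ⟨e3 0, ?_⟩
  · exact (((continuous_gradCoeff 1).pow 2).mul (continuous_norm.pow 2)).isOpen_support
  · have := scaledW_pos 1 (e3 0)
    simp [gradCoeff, e3] at this ⊢
    exact this.ne'

section Pairing

variable {D : E3 → ℂ} {q : E3 → ℝ}

/-- The weighted Young inequality behind all the domination arguments. -/
lemma norm_smul_le_half_add {a X Y : ℝ} {x : E3} (hX : 0 ≤ X) (hY : 0 ≤ Y)
    (hDq : ‖D x‖ ^ 2 ≤ ‖x‖ ^ 2 * q x) (h : a ^ 2 * ‖x‖ ^ 2 * q x ≤ X * Y) :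
    ‖a • D x‖ ≤ (X + Y) / 2 := by
  rw [norm_smul]
  refine (abs_le_of_sq_le_sq' ?_ (by positivity)).2
  rw [mul_pow, Real.norm_eq_abs, sq_abs]
  nlinarith [sq_nonneg (X - Y), mul_le_mul_of_nonneg_left hDq (sq_nonneg a)]

variable (hD : AEStronglyMeasurable D) (hq : Integrable q) (hq0 : ∀ x, 0 ≤ q x)
  (hDq : ∀ x, ‖D x‖ ^ 2 ≤ ‖x‖ ^ 2 * q x)

include hD hq hq0 hDq

lemma integrable_smul_of_sq_le {a : E3 → ℝ} (ha : Continuous a)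
    (hi : Integrable (fun x => a x ^ 2 * ‖x‖ ^ 2)) : Integrable (fun x => a x • D x) :=
  ((hi.add hq).div_const 2).mono' (ha.aestronglyMeasurable.smul hD) <| .of_forall fun x =>
    norm_smul_le_half_add (by positivity) (hq0 x) (hDq x) le_rfl

lemma integrable_gradCoeff_smul {μ : ℝ} (hμ : 0 < μ) :
    Integrable (fun x => gradCoeff μ x • D x) :=
  integrable_smul_of_sq_le hD hq hq0 hDq (continuous_gradCoeff μ) (integrable_gradCoeff_sq hμ)

lemma hasDerivAt_integral_gradCoeff_smul {μ : ℝ} (hμ : 0 < μ) :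
    HasDerivAt (fun ν => ∫ x, gradCoeff ν x • D x)
      (μ⁻¹ • ∫ x, gradCoeff₁ μ x • D x) μ := by
  have key := hasDerivAt_integral_of_dominated_loc_of_deriv_le (𝕜 := ℝ) (μ := volume) (x₀ := μ)
    (s := Set.Ioo (μ / 2) (2 * μ))
    (F := fun ν x => gradCoeff ν x • D x) (F' := fun ν x => (ν⁻¹ * gradCoeff₁ ν x) • D x)
    (bound := fun x => (24 * μ * 4 * scaledW (μ / 2) x ^ 4 + q x) / 2)
    (Ioo_mem_nhds (by linarith) (by linarith))
    (.of_forall fun ν => (continuous_gradCoeff ν).aestronglyMeasurable.smul hD)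
    (integrable_gradCoeff_smul hD hq hq0 hDq hμ)
    (((continuous_gradCoeff₁ μ).const_mul _).aestronglyMeasurable.smul hD)
    (.of_forall fun x ν hν => ?_)
    ((((integrable_scaledW_pow_four (half_pos hμ)).const_mul _).add hq).div_const 2)
    (.of_forall fun x ν hν => ?_)
  · simpa only [mul_smul, integral_smul] using key.2
  · have hν0 : 0 < ν := (half_pos hμ).trans hν.1
    have hu := scaledW_pos ν x
    have hu2 := scaledW_pos (μ / 2) x
    refine norm_smul_le_half_add (by positivity) (hq0 x) (hDq x) ?_
    refine mul_le_mul_of_nonneg_right ?_ (hq0 x)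
    calc (ν⁻¹ * gradCoeff₁ ν x) ^ 2 * ‖x‖ ^ 2
        = (ν⁻¹) ^ 2 * (gradCoeff₁ ν x ^ 2 * ‖x‖ ^ 2) := by ring
      _ ≤ (ν⁻¹) ^ 2 * (3 * ν ^ 3 * scaledW ν x ^ 4) := by
        exact mul_le_mul_of_nonneg_left (gradCoeff₁_sq_le ν hν0 x) (by positivity)
      _ = 3 * ν * scaledW ν x ^ 4 := by field_simp
      _ ≤ 3 * (2 * μ) * scaledW (μ / 2) x ^ 4 := by
        gcongr
        · exact hν.2.le
        · exact scaledW_anti (by positivity) hν.1.le x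
      _ ≤ _ := by nlinarith [mul_pos hμ (pow_pos hu2 4)]
  · exact (hasDerivAt_gradCoeff ((half_pos hμ).trans hν.1) x).smul_const (D x)

end Pairing

/-- A bounded scale-invariant weight which vanishes as `μ|x|` tends to `0` or `∞`. -/
def scaleWeight (μ : ℝ) (x : E3) : ℝ :=
  μ ^ 2 * ‖x‖ ^ 2 * scaledW μ x ^ 2 * √(scaledW μ x)

lemma scaleWeight_nonneg (μ : ℝ) (x : E3) : 0 ≤ scaleWeight μ x := by
  unfold scaleWeight; positivity

lemma scaleWeight_le (μ : ℝ) (x : E3) : scaleWeight μ x ≤ 3 * √(scaledW μ x) := by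
  unfold scaleWeight
  gcongr
  nlinarith [scaledW_sq_mul μ x, sq_nonneg (scaledW μ x)]

lemma scaleWeight_le_three (μ : ℝ) (x : E3) : scaleWeight μ x ≤ 3 := by
  refine (scaleWeight_le μ x).trans ?_
  have : √(scaledW μ x) ≤ 1 := by simpa using scaledW_le_one μ x
  linarith

lemma tendsto_scaleWeight_atTop (x : E3) :
    Filter.Tendsto (scaleWeight · x) Filter.atTop (nhds 0) := by
  rcases eq_or_ne x 0 with rfl | hx
  · simp [scaleWeight]
  have hx' : 0 < ‖x‖ ^ 2 / 3 := by have := norm_pos_iff.2 hx; positivity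
  have h0 : Filter.Tendsto (fun μ : ℝ => 1 + ‖x‖ ^ 2 / 3 * μ ^ 2) Filter.atTop Filter.atTop :=
    Filter.tendsto_atTop_add_const_left _ _
      ((Filter.tendsto_pow_atTop two_ne_zero).const_mul_atTop hx')
  have h1 : Filter.Tendsto (scaledW · x) Filter.atTop (nhds 0) := by
    refine (tendsto_inv_atTop_zero.comp (Real.tendsto_sqrt_atTop.comp h0)).congr fun μ => ?_
    simp only [Function.comp, scaledW]
    congr 3
    ring
  have h2 := h1.sqrt.const_mul 3
  rw [Real.sqrt_zero, mul_zero] at h2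
  exact squeeze_zero (scaleWeight_nonneg · x) (scaleWeight_le · x) h2

lemma tendsto_scaleWeight_zero (x : E3) :
    Filter.Tendsto (scaleWeight · x) (nhds 0) (nhds 0) := by
  have h : Filter.Tendsto (fun μ : ℝ => μ ^ 2 * ‖x‖ ^ 2) (nhds 0) (nhds 0) := by
    have : Continuous (fun μ : ℝ => μ ^ 2 * ‖x‖ ^ 2) := by fun_prop
    simpa using this.tendsto 0
  refine squeeze_zero (scaleWeight_nonneg · x) (fun μ => ?_) h
  have h1 : √(scaledW μ x) ≤ 1 := by simpa using scaledW_le_one μ x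
  have h2 : scaledW μ x ^ 2 ≤ 1 := pow_le_one₀ (scaledW_pos μ x).le (scaledW_le_one μ x)
  unfold scaleWeight
  rw [mul_assoc]
  exact mul_le_of_le_one_right (by positivity) (mul_le_one₀ h2 (by positivity) h1)

lemma continuous_scaleWeight (μ : ℝ) : Continuous (scaleWeight μ) := by
  have := continuous_scaledW μ
  unfold scaleWeight
  fun_prop

lemma gradCoeff_sq_eq {μ : ℝ} (hμ : 0 < μ) (x : E3) :
    gradCoeff μ x ^ 2 * ‖x‖ ^ 2
      = 1 / 9 * (μ ^ 3 * (scaledW μ x ^ 3 * √(scaledW μ x))) * scaleWeight μ x := by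
  have h : √(scaledW μ x) ^ 2 = scaledW μ x := Real.sq_sqrt (scaledW_pos μ x).le
  have h' : √μ ^ 2 = μ := Real.sq_sqrt hμ.le
  unfold gradCoeff scaleWeight
  linear_combination (1 / 9 * μ ^ 4 * scaledW μ x ^ 6 * ‖x‖ ^ 2) * h'
    - (1 / 9 * μ ^ 5 * scaledW μ x ^ 5 * ‖x‖ ^ 2) * h

/-- The rescaled ground states converge weakly to zero when the scale degenerates. -/
lemma tendsto_integral_gradCoeff_smul {D : E3 → ℂ} {q : E3 → ℝ}
    (hq : Integrable q) (hq0 : ∀ x, 0 ≤ q x)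
    (hDq : ∀ x, ‖D x‖ ^ 2 ≤ ‖x‖ ^ 2 * q x) {ι : Type*} {l : Filter ι} [l.IsCountablyGenerated]
    {s : ι → ℝ} (hs : ∀ i, 0 < s i)
    (hl : ∀ x, Filter.Tendsto (fun i => scaleWeight (s i) x) l (nhds 0)) :
    Filter.Tendsto (fun i => ∫ x, gradCoeff (s i) x • D x) l (nhds 0) := by
  have hqw : ∀ i, Integrable (fun x => scaleWeight (s i) x * q x) := fun i =>
    (hq.const_mul 3).mono' ((continuous_scaleWeight _).aestronglyMeasurable.mul
      hq.aestronglyMeasurable) <| .of_forall fun x => by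
        rw [Real.norm_of_nonneg (mul_nonneg (scaleWeight_nonneg _ _) (hq0 x))]
        exact mul_le_mul_of_nonneg_right (scaleWeight_le_three _ _) (hq0 x)
  have hlim : Filter.Tendsto (fun i => ∫ x, scaleWeight (s i) x * q x) l (nhds 0) := by
    have := tendsto_integral_filter_of_dominated_convergence (μ := volume) (l := l)
      (F := fun i x => scaleWeight (s i) x * q x) (f := fun _ => 0) (fun x => 3 * q x)
      (.of_forall fun i => (hqw i).aestronglyMeasurable)
      (.of_forall fun i => .of_forall fun x => by
        rw [Real.norm_of_nonneg (mul_nonneg (scaleWeight_nonneg _ _) (hq0 x))]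
        exact mul_le_mul_of_nonneg_right (scaleWeight_le_three _ _) (hq0 x))
      (hq.const_mul 3) (.of_forall fun x => by simpa using (hl x).mul_const (q x))
    simpa using this
  set V := ∫ x : E3, scaledW 1 x ^ 3 * √(scaledW 1 x) with hV
  have hV0 : 0 ≤ V := integral_nonneg fun x => by have := scaledW_pos 1 x; positivity
  have hbound : ∀ i, ∀ r > 0, ‖∫ x, gradCoeff (s i) x • D x‖
      ≤ (r * V + r⁻¹ * ∫ x, scaleWeight (s i) x * q x) / 2 := fun i r hr => by
    have hμ := hs i
    have hVi : ∫ x : E3, s i ^ 3 * (scaledW (s i) x ^ 3 * √(scaledW (s i) x)) = V := by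
      rw [hV, ← integral_comp_smul_E3 hμ fun x => scaledW 1 x ^ 3 * √(scaledW 1 x)]
      simp only [← scaledW_eq_comp_smul]
    have hi := (integrable_scaledW_pow_mul_sqrt hμ).const_mul (s i ^ 3)
    rw [← hVi, ← integral_const_mul, ← integral_const_mul,
      ← integral_add (hi.const_mul r) ((hqw i).const_mul _), ← integral_div]
    refine norm_integral_le_of_norm_le (((hi.const_mul r).add ((hqw i).const_mul _)).div_const 2)
      (.of_forall fun x => ?_)
    have hu := scaledW_pos (s i) x
    have hw := scaleWeight_nonneg (s i) x
    have hqx := hq0 x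
    refine norm_smul_le_half_add (by positivity) (by positivity) (hDq x) ?_
    rw [gradCoeff_sq_eq hμ]
    have : 0 ≤ s i ^ 3 * (scaledW (s i) x ^ 3 * √(scaledW (s i) x)) * (scaleWeight (s i) x * q x) :=
      by positivity
    have hrr : r * r⁻¹ = 1 := mul_inv_cancel₀ hr.ne'
    generalize s i ^ 3 * (scaledW (s i) x ^ 3 * √(scaledW (s i) x)) = a at *
    generalize scaleWeight (s i) x = b at *
    calc _ = 1 / 9 * (a * (b * q x)) := by ring
      _ ≤ a * (b * q x) := by linarith
      _ = r * r⁻¹ * (a * (b * q x)) := by rw [hrr, one_mul]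
      _ = _ := by ring
  rw [Metric.tendsto_nhds]
  intro η hη
  have hr : 0 < η / (V + 1) := by positivity
  filter_upwards [hlim.eventually (gt_mem_nhds (mul_pos hr hη))] with i hi
  rw [dist_zero_right]
  refine (hbound i _ hr).trans_lt ?_
  have h1 : η / (V + 1) * V < η := by
    rw [div_mul_eq_mul_div, div_lt_iff₀ (by positivity)]
    nlinarith
  have h2 : (η / (V + 1))⁻¹ * ∫ x, scaleWeight (s i) x * q x < η := by
    rw [inv_mul_lt_iff₀ hr]
    exact hi
  linarith

lemma fderiv_apply_eq_sum {F : Type*} [NormedAddCommGroup F] [NormedSpace ℝ F] (L : E3 →L[ℝ] F)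
    (x : E3) : L x = ∑ j, x j • L (e3 j) := by
  conv_lhs => rw [← (EuclideanSpace.basisFun (Fin 3) ℝ).sum_repr x]
  simp [e3]

lemma norm_fderiv_self_sq_le (f : E3 → ℂ) (x : E3) :
    ‖fderiv ℝ f x x‖ ^ 2 ≤ ‖x‖ ^ 2 * gradSqC f x := by
  have h1 : ‖fderiv ℝ f x x‖ ≤ ∑ j, |x j| * ‖pdC j f x‖ := by
    rw [fderiv_apply_eq_sum (fderiv ℝ f x) x]
    refine (norm_sum_le _ _).trans_eq (Finset.sum_congr rfl fun j _ => ?_)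
    rw [norm_smul, Real.norm_eq_abs, pdC]
  calc _ ≤ (∑ j, |x j| * ‖pdC j f x‖) ^ 2 := by gcongr
    _ ≤ (∑ j, |x j| ^ 2) * ∑ j, ‖pdC j f x‖ ^ 2 := Finset.sum_mul_sq_le_sq_mul_sq _ _ _
    _ = _ := by simp only [sq_abs, EuclideanSpace.real_norm_sq_eq, gradSqC]

lemma gradSqC_nonneg (f : E3 → ℂ) (x : E3) : 0 ≤ gradSqC f x :=
  Finset.sum_nonneg fun _ _ => by positivity

lemma continuous_fderiv_self {f : E3 → ℂ} (hf : ContDiff ℝ 1 f) :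
    Continuous fun x => fderiv ℝ f x x :=
  (hf.continuous_fderiv one_ne_zero).clm_apply continuous_id

lemma inner_e3 (x : E3) (j : Fin 3) : inner ℝ x (e3 j) = x j := by
  simp [e3, EuclideanSpace.inner_single_right]

lemma pdR_eq {h : E3 → ℝ} {b : ℝ} {x : E3} (hh : HasFDerivAt h (b • innerSL ℝ x) x) (j : Fin 3) :
    pdR j h x = b * x j := by
  rw [pdR, hh.fderiv]
  simp [inner_e3]

lemma hasFDerivAt_modG {f : E3 → ℂ} (hf : Differentiable ℝ f) (θ μ : ℝ) (x : E3) :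
    HasFDerivAt (modG f θ μ) (exp (-θ * I) • fderiv ℝ f x
      - ofRealCLM.comp (gradCoeff μ x • innerSL ℝ x)) x :=
  ((hf x).hasFDerivAt.const_mul _).sub
    (ofRealCLM.hasFDerivAt.comp x (hasFDerivAt_rescaledW μ x))

lemma fderiv_modG_self {f : E3 → ℂ} (hf : Differentiable ℝ f) (θ μ : ℝ) (x : E3) :
    fderiv ℝ (modG f θ μ) x x
      = exp (-θ * I) * fderiv ℝ f x x - ((gradCoeff μ x * ‖x‖ ^ 2 : ℝ) : ℂ) := by
  rw [(hasFDerivAt_modG hf θ μ x).fderiv]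
  simp

lemma pdC_modG {f : E3 → ℂ} (hf : Differentiable ℝ f) (θ μ : ℝ) (x : E3) (j : Fin 3) :
    pdC j (modG f θ μ) x = exp (-θ * I) * pdC j f x - ((gradCoeff μ x * x j : ℝ) : ℂ) := by
  rw [pdC, (hasFDerivAt_modG hf θ μ x).fderiv]
  simp [inner_e3, pdC]

lemma norm_exp_neg_mul_I (θ : ℝ) : ‖exp (-θ * I)‖ = 1 := by
  rw [← ofReal_neg, norm_exp_ofReal_mul_I]

lemma gradSqC_modG {f : E3 → ℂ} (hf : Differentiable ℝ f) (θ μ : ℝ) (x : E3) :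
    gradSqC (modG f θ μ) x = gradSqC f x
      - 2 * (exp (-θ * I) * (gradCoeff μ x • fderiv ℝ f x x)).re
      + gradCoeff μ x ^ 2 * ‖x‖ ^ 2 := by
  have hp : ∀ (z : ℂ) (t : ℝ), ‖exp (-θ * I) * z - (t : ℂ)‖ ^ 2
      = ‖z‖ ^ 2 - 2 * (exp (-θ * I) * (t • z)).re + t ^ 2 := fun z t => by
    have h1 : ‖z‖ ^ 2 = ‖exp (-θ * I) * z‖ ^ 2 := by
      rw [norm_mul, norm_exp_neg_mul_I, one_mul]
    rw [h1, mul_smul_comm]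
    generalize exp (-θ * I) * z = w
    simp only [← normSq_eq_norm_sq, normSq_apply, sub_re, sub_im, ofReal_re, ofReal_im, smul_re,
      smul_eq_mul]
    ring
  rw [fderiv_apply_eq_sum (fderiv ℝ f x) x, EuclideanSpace.real_norm_sq_eq]
  simp only [gradSqC, pdC_modG hf, hp, Finset.sum_add_distrib, Finset.sum_sub_distrib,
    Finset.mul_sum, Finset.smul_sum, re_sum, mul_pow, smul_smul]
  rfl

lemma gradSqC_sub_groundC {f : E3 → ℂ} (hf : Differentiable ℝ f) (θ μ : ℝ) (x : E3) :
    gradSqC (fun x => f x - groundC θ μ x) x = gradSqC (modG f θ μ) x := by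
  have h : (fun x => f x - groundC θ μ x) = fun x => exp (θ * I) * modG f θ μ x := by
    ext y
    have : exp (θ * I) * exp (-θ * I) = 1 := by rw [← exp_add]; simp
    simp only [groundC, modG]
    push_cast
    linear_combination (-f y) * this
  have hd := (hasFDerivAt_modG hf θ μ x).const_mul (exp (θ * I))
  simp only [gradSqC, pdC]
  rw [h, hd.fderiv, (hasFDerivAt_modG hf θ μ x).fderiv]
  simp only [smul_apply, norm_smul, norm_exp_ofReal_mul_I, one_mul]

lemma sum_pdR_re_mul {g : E3 → ℂ} {h : E3 → ℝ} {b : ℝ} {x : E3} (hg : DifferentiableAt ℝ g x)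
    (hh : HasFDerivAt h (b • innerSL ℝ x) x) :
    ∑ j, pdR j (fun y => (g y).re) x * pdR j h x = (b • fderiv ℝ g x x).re := by
  have hre : HasFDerivAt (fun y => (g y).re) (reCLM.comp (fderiv ℝ g x)) x :=
    reCLM.hasFDerivAt.comp x hg.hasFDerivAt
  simp only [pdR_eq hh]
  simp only [pdR, hre.fderiv]
  rw [fderiv_apply_eq_sum (fderiv ℝ g x) x]
  simp only [Finset.smul_sum, re_sum, smul_re, smul_eq_mul, ContinuousLinearMap.comp_apply,
    reCLM_apply]
  exact Finset.sum_congr rfl fun j _ => by ring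

lemma sum_pdR_im_mul {g : E3 → ℂ} {h : E3 → ℝ} {b : ℝ} {x : E3} (hg : DifferentiableAt ℝ g x)
    (hh : HasFDerivAt h (b • innerSL ℝ x) x) :
    ∑ j, pdR j (fun y => (g y).im) x * pdR j h x = (b • fderiv ℝ g x x).im := by
  have him : HasFDerivAt (fun y => (g y).im) (imCLM.comp (fderiv ℝ g x)) x :=
    imCLM.hasFDerivAt.comp x hg.hasFDerivAt
  simp only [pdR_eq hh]
  simp only [pdR, him.fderiv]
  rw [fderiv_apply_eq_sum (fderiv ℝ g x) x]
  simp only [Finset.smul_sum, im_sum, smul_im, smul_eq_mul, ContinuousLinearMap.comp_apply,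
    imCLM_apply]
  exact Finset.sum_congr rfl fun j _ => by ring

/-- The complex pairing `∫ ∇f · ∇(μ^{1/2} W(μ·))`. -/
def pairing (f : E3 → ℂ) (μ : ℝ) : ℂ := ∫ x, gradCoeff μ x • fderiv ℝ f x x

/-- By scale invariance, `‖∇(μ^{1/2} W(μ·))‖` is stationary in `μ`. -/
lemma integral_gradCoeff₁_mul_gradCoeff {μ : ℝ} (hμ : 0 < μ) :
    Integrable (fun x : E3 => gradCoeff₁ μ x * (gradCoeff μ x * ‖x‖ ^ 2)) ∧
      ∫ x : E3, gradCoeff₁ μ x * (gradCoeff μ x * ‖x‖ ^ 2) = 0 := by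
  set D : E3 → ℂ := fun x => ((gradCoeff μ x * ‖x‖ ^ 2 : ℝ) : ℂ) with hDdef
  have hcD : Continuous D := by
    have := continuous_gradCoeff μ
    fun_prop
  have hD := hcD.aestronglyMeasurable (μ := volume)
  have hq := integrable_gradCoeff_sq hμ
  have hq0 : ∀ x : E3, 0 ≤ gradCoeff μ x ^ 2 * ‖x‖ ^ 2 := fun x => by positivity
  have hDq : ∀ x, ‖D x‖ ^ 2 ≤ ‖x‖ ^ 2 * (gradCoeff μ x ^ 2 * ‖x‖ ^ 2) := fun x => by
    rw [hDdef, norm_real, Real.norm_eq_abs, sq_abs]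
    exact le_of_eq (by ring)
  have hint : Integrable (fun x => gradCoeff₁ μ x • D x) :=
    integrable_smul_of_sq_le hD hq hq0 hDq (continuous_gradCoeff₁ μ)
      (integrable_gradCoeff₁_sq hμ)
  have hre := (reCLM.hasFDerivAt.comp_hasDerivAt μ
    (hasDerivAt_integral_gradCoeff_smul hD hq hq0 hDq hμ))
  have hmax : IsLocalMax (fun ν => reCLM (∫ x, gradCoeff ν x • D x)) μ := by
    filter_upwards [lt_mem_nhds hμ] with ν hν
    have e : ∀ {ν : ℝ}, 0 < ν → reCLM (∫ x, gradCoeff ν x • D x)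
        = ∫ x, gradCoeff ν x * (gradCoeff μ x * ‖x‖ ^ 2) := fun hν => by
      rw [← reCLM.integral_comp_comm (integrable_gradCoeff_smul hD hq hq0 hDq hν)]
      simp only [hDdef, reCLM_apply, smul_re, smul_eq_mul, ofReal_re]
    have hi : Integrable fun x => gradCoeff ν x * (gradCoeff μ x * ‖x‖ ^ 2) := by
      simpa only [hDdef, reCLM_apply, smul_re, smul_eq_mul, ofReal_re] using reCLM.integrable_comp (integrable_gradCoeff_smul hD hq hq0 hDq hν)
    rw [e hν, e hμ]
    have h1 : ∫ x : E3, gradCoeff ν x * (gradCoeff μ x * ‖x‖ ^ 2)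
        ≤ ∫ x : E3, (gradCoeff ν x ^ 2 * ‖x‖ ^ 2 + gradCoeff μ x ^ 2 * ‖x‖ ^ 2) / 2 := by
      refine integral_mono hi (((integrable_gradCoeff_sq hν).add hq).div_const 2) fun x => ?_
      have := mul_nonneg (sq_nonneg (gradCoeff ν x - gradCoeff μ x)) (sq_nonneg ‖x‖)
      dsimp only
      linarith
    rw [integral_div, integral_add (integrable_gradCoeff_sq hν) hq, integral_gradCoeff_sq hν,
      ← integral_gradCoeff_sq hμ, add_self_div_two] at h1
    refine h1.trans_eq ?_
    congr 1 with x
    ring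
  have h0 := hmax.hasDerivAt_eq_zero hre
  rw [map_smul, ← reCLM.integral_comp_comm hint, smul_eq_zero] at h0
  refine ⟨by simpa only [hDdef, reCLM_apply, smul_re, smul_eq_mul, ofReal_re] using reCLM.integrable_comp hint, ?_⟩
  simpa only [hDdef, reCLM_apply, smul_re, smul_eq_mul, ofReal_re] using h0.resolve_left (inv_pos.2 hμ).ne'

section Gradient

variable {f : E3 → ℂ} (hf : ContDiff ℝ 1 f) (hfi : Integrable (gradSqC f))

include hf hfi

lemma integrable_gradCoeff_smul_fderiv {μ : ℝ} (hμ : 0 < μ) :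
    Integrable (fun x => gradCoeff μ x • fderiv ℝ f x x) :=
  integrable_gradCoeff_smul (continuous_fderiv_self hf).aestronglyMeasurable hfi
    (gradSqC_nonneg f) (norm_fderiv_self_sq_le f) hμ

lemma integrable_gradCoeff₁_smul_fderiv {μ : ℝ} (hμ : 0 < μ) :
    Integrable (fun x => gradCoeff₁ μ x • fderiv ℝ f x x) :=
  integrable_smul_of_sq_le (continuous_fderiv_self hf).aestronglyMeasurable hfi
    (gradSqC_nonneg f) (norm_fderiv_self_sq_le f) (continuous_gradCoeff₁ μ)
    (integrable_gradCoeff₁_sq hμ)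

lemma hasDerivAt_pairing {μ : ℝ} (hμ : 0 < μ) :
    HasDerivAt (pairing f) (μ⁻¹ • ∫ x, gradCoeff₁ μ x • fderiv ℝ f x x) μ :=
  hasDerivAt_integral_gradCoeff_smul (continuous_fderiv_self hf).aestronglyMeasurable hfi
    (gradSqC_nonneg f) (norm_fderiv_self_sq_le f) hμ

lemma integral_gradSqC_modG (θ : ℝ) {μ : ℝ} (hμ : 0 < μ) :
    ∫ x, gradSqC (modG f θ μ) x = (∫ x, gradSqC f x) - 2 * (exp (-θ * I) * pairing f μ).re
      + ∫ x : E3, gradCoeff 1 x ^ 2 * ‖x‖ ^ 2 := by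
  have hi := (integrable_gradCoeff_smul_fderiv hf hfi hμ).const_mul (exp (-θ * I))
  have hre : Integrable fun x => (exp (-θ * I) * (gradCoeff μ x • fderiv ℝ f x x)).re :=
    reCLM.integrable_comp hi
  have hsub : Integrable fun x =>
      gradSqC f x - 2 * (exp (-θ * I) * (gradCoeff μ x • fderiv ℝ f x x)).re :=
    hfi.sub (hre.const_mul 2)
  simp only [gradSqC_modG (hf.differentiable one_ne_zero)]
  rw [integral_add hsub (integrable_gradCoeff_sq hμ),
    integral_sub hfi (hre.const_mul 2), integral_const_mul, integral_gradCoeff_sq hμ, pairing,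
    ← integral_const_mul (exp (-θ * I))]
  congr 3
  exact reCLM.integral_comp_comm hi

/-- If the pairing does not vanish identically, its modulus is maximal at some scale. -/
lemma exists_norm_pairing_max {ν : ℝ} (hν : 0 < ν) (hne : pairing f ν ≠ 0) :
    ∃ μ > 0, ∀ ν > 0, ‖pairing f ν‖ ≤ ‖pairing f μ‖ := by
  have hc : Continuous fun t => ‖pairing f (Real.exp t)‖ :=
    (continuous_iff_continuousAt.2 fun t => ContinuousAt.comp (g := pairing f)
      (hasDerivAt_pairing hf hfi (Real.exp_pos t)).continuousAt
      Real.continuous_exp.continuousAt).norm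
  have hlim : Filter.Tendsto (fun t => ‖pairing f (Real.exp t)‖) (Filter.cocompact ℝ)
      (nhds 0) := by
    rw [cocompact_eq_atBot_atTop, Filter.tendsto_sup]
    constructor <;> rw [← norm_zero (E := ℂ)] <;> refine (tendsto_integral_gradCoeff_smul hfi
      (gradSqC_nonneg f) (norm_fderiv_self_sq_le f) Real.exp_pos fun x => ?_).norm
    · exact (tendsto_scaleWeight_zero x).comp Real.tendsto_exp_atBot
    · exact (tendsto_scaleWeight_atTop x).comp Real.tendsto_exp_atTop
  have hν' : Real.exp (Real.log ν) = ν := Real.exp_log hν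
  obtain ⟨t, ht⟩ := hc.exists_forall_ge' (Real.log ν) <| by
    filter_upwards [hlim.eventually (gt_mem_nhds (norm_pos_iff.2 hne))] with t ht
    rw [hν']
    exact ht.le
  refine ⟨Real.exp t, Real.exp_pos t, fun μ hμ => ?_⟩
  simpa [Real.exp_log hμ] using ht (Real.log μ)

lemma orthogonality_im {θ μ : ℝ} (hμ : 0 < μ) (h : (exp (-θ * I) * pairing f μ).im = 0) :
    ∫ x : E3, ∑ j, pdR j (fun y => (modG f θ μ y).im) x
      * pdR j (fun y => √μ * W (μ • y)) x = 0 := by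
  have hd := hf.differentiable one_ne_zero
  have hi := (integrable_gradCoeff_smul_fderiv hf hfi hμ).const_mul (exp (-θ * I))
  rw [pairing, ← integral_const_mul] at h
  rw [← h]
  refine Eq.trans (integral_congr_ae (.of_forall fun x => ?_)) (imCLM.integral_comp_comm hi)
  dsimp only
  rw [sum_pdR_im_mul (hasFDerivAt_modG hd θ μ x).differentiableAt (hasFDerivAt_rescaledW μ x),
    fderiv_modG_self hd, mul_smul_comm, imCLM_apply, smul_im, smul_im, sub_im, ofReal_im, sub_zero]

lemma orthogonality_re {θ μ : ℝ} (hμ : 0 < μ)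
    (h : ∀ ν > 0, (exp (-θ * I) * pairing f ν).re ≤ (exp (-θ * I) * pairing f μ).re) :
    ∫ x : E3, ∑ j, pdR j (fun y => (modG f θ μ y).re) x
      * pdR j (fun y => √μ * W1 (μ • y)) x = 0 := by
  have hd := hf.differentiable one_ne_zero
  have hi := (integrable_gradCoeff₁_smul_fderiv hf hfi hμ).const_mul (exp (-θ * I))
  have hmax : IsLocalMax (fun ν => reCLM (exp (-θ * I) * pairing f ν)) μ := by
    filter_upwards [lt_mem_nhds hμ] with ν hν using h ν hν
  have h0 := hmax.hasDerivAt_eq_zero (reCLM.hasFDerivAt.comp_hasDerivAt μ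
    ((hasDerivAt_pairing hf hfi hμ).const_mul (exp (-θ * I))))
  rw [mul_smul_comm, map_smul, ← integral_const_mul, ← reCLM.integral_comp_comm hi,
    smul_eq_zero] at h0
  have h1 := h0.resolve_left (inv_pos.2 hμ).ne'
  obtain ⟨hi2, h2⟩ := integral_gradCoeff₁_mul_gradCoeff hμ
  rw [← sub_zero (0 : ℝ)]
  nth_rewrite 1 [← h1]
  rw [← h2, ← integral_sub (reCLM.integrable_comp hi) hi2]
  refine integral_congr_ae (.of_forall fun x => ?_)
  dsimp only
  rw [sum_pdR_re_mul (hasFDerivAt_modG hd θ μ x).differentiableAt (hasFDerivAt_rescaledW1 μ x),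
    fderiv_modG_self hd, mul_smul_comm, reCLM_apply, smul_re, smul_re, sub_re, ofReal_re,
    smul_eq_mul, smul_eq_mul, mul_sub]

end Gradient

/-- Existence of modulation parameters satisfying the orthogonality conditions. -/
theorem modulation_parameters_exist :
    ∃ δ₀ > (0:ℝ), ∃ C > (0:ℝ), ∀ f : E3 → ℂ, IsRadial f → ContDiff ℝ 1 f →
      Integrable (fun x : E3 => ‖f x‖ ^ 6) → Integrable (gradSqC f) →
      ∀ ε : ℝ,
      ε = sInf { r : ℝ | ∃ (θ μ : ℝ), 0 < μ ∧
            r = Real.sqrt (∫ x : E3, gradSqC (fun x => f x - groundC θ μ x) x) } →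
      ε < δ₀ →
      ∃ (θ μ : ℝ), 0 < μ ∧
        Real.sqrt (∫ x : E3, gradSqC (modG f θ μ) x) ≤ C * ε ∧
        (∫ x : E3, ∑ j, pdR j (fun y => (modG f θ μ y).im) x
            * pdR j (fun y => Real.sqrt μ * W (μ • y)) x) = 0 ∧
        (∫ x : E3, ∑ j, pdR j (fun y => (modG f θ μ y).re) x
            * pdR j (fun y => Real.sqrt μ * W1 (μ • y)) x) = 0 := by
  set K := ∫ x : E3, gradCoeff 1 x ^ 2 * ‖x‖ ^ 2 with hK
  have hK0 : 0 < K := integral_gradCoeff_one_sq_pos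
  refine ⟨√K, Real.sqrt_pos.2 hK0, 1, one_pos, fun f _ hf _ hfi ε hε hεδ => ?_⟩
  have hd := hf.differentiable one_ne_zero
  simp only [gradSqC_sub_groundC hd] at hε
  have hdist := fun θ {μ : ℝ} (hμ : 0 < μ) => integral_gradSqC_modG hf hfi θ hμ
  have hne : {r : ℝ | ∃ θ μ : ℝ, 0 < μ ∧ r = √(∫ x, gradSqC (modG f θ μ) x)}.Nonempty :=
    ⟨_, 0, 1, one_pos, rfl⟩
  obtain ⟨ν, hν, hνf⟩ : ∃ ν > 0, pairing f ν ≠ 0 := by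
    by_contra! h
    refine hεδ.not_ge (hε ▸ le_csInf hne ?_)
    rintro r ⟨θ, μ, hμ, rfl⟩
    refine Real.sqrt_le_sqrt ?_
    rw [hdist θ hμ, h μ hμ, mul_zero, zero_re, mul_zero, sub_zero]
    exact le_add_of_nonneg_left (integral_nonneg (gradSqC_nonneg f))
  obtain ⟨μ, hμ, hmax⟩ := exists_norm_pairing_max hf hfi hν hνf
  set θ := arg (pairing f μ)
  have hrot : exp (-θ * I) * pairing f μ = (‖pairing f μ‖ : ℂ) := by
    conv_lhs => rw [← norm_mul_exp_arg_mul_I (pairing f μ)]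
    rw [mul_left_comm, ← exp_add]
    simp [θ]
  have hre : ∀ φ : ℝ, ∀ ν > 0,
      (exp (-φ * I) * pairing f ν).re ≤ (exp (-θ * I) * pairing f μ).re := fun φ ν hν => by
    rw [hrot, ofReal_re]
    refine (re_le_norm _).trans ?_
    rw [norm_mul, norm_exp_neg_mul_I, one_mul]
    exact hmax ν hν
  refine ⟨θ, μ, hμ, ?_, orthogonality_im hf hfi hμ (by rw [hrot, ofReal_im]),
    orthogonality_re hf hfi hμ (hre θ)⟩
  rw [one_mul, hε]
  refine le_csInf hne ?_
  rintro r ⟨φ, ν, hν, rfl⟩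
  refine Real.sqrt_le_sqrt ?_
  rw [hdist θ hμ, hdist φ hν]
  linarith [hre φ ν hν]
end
end
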